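/- Fix an integer r ≥ 1, nonzero integers a_1, …, a_r with a_i ≠ ±a_j for all i ≠ j, and an integer k > 1. Then for every bounded continuous function g : ℝ^r → ℝ, the averages (1/p^k) Σ_χ g(𝒦_{p^k}(a_1,χ), …, 𝒦_{p^k}(a_r,χ)), where χ ranges over all multiplicative characters of (ℤ/p^kℤ)^*, converge as p → ∞ through the primes to ∫_{ℝ^r} g(x_1,…,x_r) dμ(x_1)⋯dμ(x_r), the integral of g against the r-fold product measure μ^r. -/

import Mathlib

open Complex MeasureTheory Finset

/-- The standard additive character `e_q(x) = exp(2πix/q)` of `ℤ/qℤ`. -/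
noncomputable def eZMod (q : ℕ) (x : ZMod q) : ℂ :=
  Complex.exp (2 * Real.pi * Complex.I * x.val / q)

/-- The twisted Kloosterman sum `K_q(a,b,χ) = ∑_{x ∈ (ℤ/qℤ)^*} e_q(ax + bx⁻¹)χ(x)`,
written as a sum over the natural representatives of the units of `ℤ/qℤ`. -/
noncomputable def Kloos (q : ℕ) (a b : ZMod q) (χ : MulChar (ZMod q) ℂ) : ℂ :=
  ∑ n ∈ (Finset.range q).filter (fun n => Nat.Coprime n q),
    eZMod q (a * (n : ZMod q) + b * ((n : ZMod q)⁻¹)) * χ (n : ZMod q)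

/-- The normalized twisted Kloosterman sum `𝒦_q(a,χ) = q^{-1/2} K_q(a,-a,χ)`,
a real number. -/
noncomputable def nKloos (q : ℕ) (a : ℤ) (χ : MulChar (ZMod q) ℂ) : ℝ :=
  (((q : ℝ) ^ (-(1/2 : ℝ))) • Kloos q (a : ZMod q) (-(a : ℤ) : ZMod q) χ).re

/-- The measure `μ = ½δ₀ + ν`, where `ν` has density `1/(2π√(4-x²))` on `(-2,2)`. -/
noncomputable def muK : Measure ℝ :=
  (1/2 : ENNReal) • Measure.dirac 0 +
    (volume.restrict (Set.Ioo (-2 : ℝ) 2)).withDensity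
      (fun x => ENNReal.ofReal (1 / (2 * Real.pi * Real.sqrt (4 - x ^ 2))))

section Stepanov

open Polynomial

variable {p : ℕ} [Fact p.Prime]

/-- The operator `r ↦ f r' + e f' r`, which satisfies `(f ^ e r)' = f ^ (e - 1) (f r' + e f' r)`. -/
noncomputable def stepanovOp (f : (ZMod p)[X]) (e : ℕ) : (ZMod p)[X] →ₗ[ZMod p] (ZMod p)[X] :=
  LinearMap.mulLeft (ZMod p) f ∘ₗ derivative +
    LinearMap.mulLeft (ZMod p) (C (e : ZMod p) * derivative f)

/-- The iterated operator, so that `(f ^ e r)⁽ᵏ⁾ = f ^ (e - k) (stepanovIter f e k r)`. -/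
noncomputable def stepanovIter (f : (ZMod p)[X]) (e : ℕ) :
    ℕ → ((ZMod p)[X] →ₗ[ZMod p] (ZMod p)[X])
  | 0 => LinearMap.id
  | k + 1 => stepanovOp f (e - k) ∘ₗ stepanovIter f e k

theorem stepanovOp_apply (f : (ZMod p)[X]) (e : ℕ) (r : (ZMod p)[X]) :
    stepanovOp f e r = f * derivative r + C (e : ZMod p) * derivative f * r := by
  simp [stepanovOp, mul_assoc]

theorem derivative_pow_succ_mul (f r : (ZMod p)[X]) (e : ℕ) :
    derivative (f ^ (e + 1) * r) = f ^ e * stepanovOp f (e + 1) r := by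
  rw [stepanovOp_apply, derivative_mul, derivative_pow_succ]
  push_cast
  ring

theorem iterate_derivative_pow_mul (f r : (ZMod p)[X]) (e k j : ℕ) (hk : k ≤ e) :
    derivative^[k] (f ^ e * r * X ^ (p * j)) =
      f ^ (e - k) * stepanovIter f e k r * X ^ (p * j) := by
  induction k with
  | zero => simp [stepanovIter]
  | succ k ih =>
    rw [Function.iterate_succ_apply', ih (by omega)]
    obtain ⟨d, hd⟩ : ∃ d, e - k = d + 1 := ⟨e - k - 1, by omega⟩
    have hX : derivative (X ^ (p * j) : (ZMod p)[X]) = 0 := by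
      simp [derivative_X_pow]
    rw [derivative_mul, hX, hd, derivative_pow_succ_mul, show e - (k + 1) = d by omega]
    simp [stepanovIter, hd]

theorem degree_stepanovOp_lt (f r : (ZMod p)[X]) (e n : ℕ) (hr : r.degree < n) :
    (stepanovOp f e r).degree < ((n + f.natDegree : ℕ) : WithBot ℕ) := by
  have h1 : r ∈ degreeLT (ZMod p) n := mem_degreeLT.2 hr
  by_cases hr0 : r = 0
  · subst hr0; simp [stepanovOp_apply]
  have hn : r.natDegree < n := (natDegree_lt_iff_degree_lt hr0).2 hr
  rw [stepanovOp_apply]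
  refine lt_of_le_of_lt (degree_add_le _ _) (max_lt ?_ ?_)
  · refine lt_of_le_of_lt degree_le_natDegree ?_
    have := natDegree_mul_le (p := f) (q := derivative r)
    have := natDegree_derivative_le r
    exact_mod_cast (by omega)
  · refine lt_of_le_of_lt degree_le_natDegree ?_
    have h2 := natDegree_mul_le (p := C (e : ZMod p) * derivative f) (q := r)
    have h3 := natDegree_C_mul_le (e : ZMod p) (derivative f)
    have := natDegree_derivative_le f
    exact_mod_cast (by omega)

theorem degree_stepanovIter_lt (f r : (ZMod p)[X]) (e k n : ℕ) (hr : r.degree < n) :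
    (stepanovIter f e k r).degree < ((n + k * f.natDegree : ℕ) : WithBot ℕ) := by
  induction k with
  | zero => simpa [stepanovIter] using hr
  | succ k ih =>
    have := degree_stepanovOp_lt f _ (e - k) _ ih
    simpa [stepanovIter, add_mul, add_assoc] using this

/-- The auxiliary polynomial of Stepanov's method. -/
noncomputable def stepanovPoly (f : (ZMod p)[X]) (l h : ℕ) {J : ℕ}
    (r s : Fin J → (ZMod p)[X]) : (ZMod p)[X] :=
  ∑ j : Fin J, (f ^ l * r j * X ^ (p * j) + f ^ (l + h) * s j * X ^ (p * j))

theorem eval_iterate_derivative_stepanovPoly (f : (ZMod p)[X]) (l h : ℕ) {J : ℕ}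
    (r s : Fin J → (ZMod p)[X]) (k : ℕ) (hk : k ≤ l) (a x : ZMod p) (hx : f.eval x ^ h = a) :
    (derivative^[k] (stepanovPoly f l h r s)).eval x = f.eval x ^ (l - k) *
      (∑ j : Fin J, (stepanovIter f l k (r j) +
        C a * stepanovIter f (l + h) k (s j)) * X ^ (j : ℕ)).eval x := by
  rw [stepanovPoly, iterate_derivative_sum, eval_finsetSum, eval_finsetSum, mul_sum]
  refine sum_congr rfl fun j _ => ?_
  rw [iterate_map_add, iterate_derivative_pow_mul _ _ _ _ _ hk,
    iterate_derivative_pow_mul _ _ _ _ _ (by omega)]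
  simp only [eval_add, eval_mul, eval_pow, eval_X, eval_C]
  rw [show l + h - k = (l - k) + h by omega, pow_add, hx, pow_mul, ZMod.pow_card]
  ring

theorem natDegree_stepanovPoly_le (f : (ZMod p)[X]) (l h D : ℕ) {J : ℕ}
    (r s : Fin J → (ZMod p)[X]) (hr : ∀ j, (r j).natDegree ≤ D) (hs : ∀ j, (s j).natDegree ≤ D) :
    (stepanovPoly f l h r s).natDegree ≤ (l + h) * f.natDegree + D + p * J := by
  refine natDegree_sum_le_of_forall_le _ _ fun j _ => ?_
  have hj : p * (j : ℕ) ≤ p * J := Nat.mul_le_mul_left _ j.2.le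
  have key : ∀ e ≤ l + h, ∀ t : (ZMod p)[X], t.natDegree ≤ D →
      (f ^ e * t * X ^ (p * (j : ℕ))).natDegree ≤ (l + h) * f.natDegree + D + p * J := by
    intro e he t ht
    have h1 := natDegree_mul_le (p := f ^ e * t) (q := X ^ (p * (j : ℕ)))
    have h2 := natDegree_mul_le (p := f ^ e) (q := t)
    have h3 := natDegree_pow_le (p := f) (n := e)
    have h4 := natDegree_X_pow_le (R := ZMod p) (p * (j : ℕ))
    have h5 := Nat.mul_le_mul_right f.natDegree he
    omega
  exact (natDegree_add_le _ _).trans (max_le (key _ (by omega) _ (hr j)) (key _ le_rfl _ (hs j)))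

/-- A polynomial with a root of odd multiplicity does not turn a square into a square. -/
theorem sq_mul_ne_C_mul_sq {F : Type*} [Field F] {f : F[X]} {x : F}
    (hf : Odd (f.rootMultiplicity x))
    {c : F} (hc : c ≠ 0) {r s : F[X]} (h : r ^ 2 * f = C c * s ^ 2) : r = 0 ∧ s = 0 := by
  have hf0 : f ≠ 0 := by rintro rfl; simp at hf
  by_cases hr : r = 0
  · subst hr
    have : C c * s ^ 2 = 0 := by rw [← h]; simp
    simpa [hc] using this
  exfalso
  have hs : s ≠ 0 := by
    rintro rfl
    simp [hr, hf0] at h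
  have h2 := congrArg (rootMultiplicity x) h
  rw [rootMultiplicity_mul (by simp [hr, hf0]), rootMultiplicity_mul (by simp [hc, hs]),
    rootMultiplicity_C, sq, sq, rootMultiplicity_mul (by simp [hr]),
    rootMultiplicity_mul (by simp [hs])] at h2
  obtain ⟨n, hn⟩ := hf
  omega

theorem stepanovPoly_ne_zero (hp : p ≠ 2) (f : (ZMod p)[X]) (h0 : f.eval 0 ≠ 0) (x : ZMod p)
    (hf : Odd (f.rootMultiplicity x)) (l D : ℕ) (hD0 : 0 < D) (hD : 2 * D + f.natDegree ≤ p) {J : ℕ}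
    (r s : Fin J → (ZMod p)[X]) (hr : ∀ j, (r j).degree < D) (hs : ∀ j, (s j).degree < D)
    (h : stepanovPoly f l (p / 2) r s = 0) : r = 0 ∧ s = 0 := by
  have hpp : p.Prime := Fact.out
  have hf0 : f ≠ 0 := by rintro rfl; simp at h0
  have hodd : 2 * (p / 2) + 1 = p := by
    have := hpp.eq_two_or_odd
    omega
  have hsum : (∑ j : Fin J, r j * X ^ (p * (j : ℕ))) +
      f ^ (p / 2) * ∑ j : Fin J, s j * X ^ (p * (j : ℕ)) = 0 := by
    have : f ^ l * ((∑ j : Fin J, r j * X ^ (p * (j : ℕ))) +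
      f ^ (p / 2) * ∑ j : Fin J, s j * X ^ (p * (j : ℕ))) = 0 := by
      rw [← h, stepanovPoly, mul_add, mul_sum, mul_sum, mul_sum, ← sum_add_distrib]
      refine sum_congr rfl fun j _ => ?_
      rw [pow_add]; ring
    exact (mul_eq_zero.1 this).resolve_left (pow_ne_zero _ hf0)
  have hfp : (X : (ZMod p)[X]) ^ p ∣ f ^ p - C (f.eval 0) := by
    rw [X_pow_dvd_iff, ← ZMod.expand_card]
    intro d hd
    rw [coeff_sub, coeff_expand hpp.pos, coeff_C]
    by_cases hd0 : d = 0
    · subst hd0; simp [coeff_zero_eq_eval_zero]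
    · rw [if_neg (fun hdvd => hd0 (Nat.eq_zero_of_dvd_of_lt hdvd hd)), if_neg hd0, sub_zero]
  suffices H : ∀ n, ∀ j : Fin J, (j : ℕ) < n → r j = 0 ∧ s j = 0 from
    ⟨funext fun j => (H (j + 1) j (Nat.lt_succ_self _)).1,
      funext fun j => (H (j + 1) j (Nat.lt_succ_self _)).2⟩
  intro n
  induction n with
  | zero => intro j hj; omega
  | succ n ih =>
    intro i hi
    rcases Nat.lt_succ_iff_lt_or_eq.1 hi with hi | hi
    · exact ih i hi
    have split : ∀ t : Fin J → (ZMod p)[X], (∀ j : Fin J, (j : ℕ) < n → t j = 0) →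
        ∃ u, ∑ j : Fin J, t j * X ^ (p * (j : ℕ)) = X ^ (p * n) * (t i + X ^ p * u) := by
      intro t ht
      refine ⟨∑ j ∈ univ.erase i, t j * X ^ (p * ((j : ℕ) - n - 1)), ?_⟩
      rw [← add_sum_erase _ _ (mem_univ i), hi, mul_add, mul_sum, mul_sum]
      congr 1
      · ring
      · refine sum_congr rfl fun j hj => ?_
        have hji : (j : ℕ) ≠ n := fun hh => (ne_of_mem_erase hj) (Fin.ext (hh.trans hi.symm))
        rcases lt_or_ge (j : ℕ) n with hlt | hge
        · simp [ht j hlt]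
        · have : p * (j : ℕ) = p * n + p + p * ((j : ℕ) - n - 1) := by
            obtain ⟨d, hd⟩ : ∃ d, (j : ℕ) = n + 1 + d := ⟨(j : ℕ) - n - 1, by omega⟩
            rw [hd, show n + 1 + d - n - 1 = d by omega]; ring
          rw [this, pow_add, pow_add]; ring
    obtain ⟨u, hu⟩ := split r fun j hj => (ih j hj).1
    obtain ⟨v, hv⟩ := split s fun j hj => (ih j hj).2
    rw [hu, hv] at hsum
    have h1 : (r i + X ^ p * u) + f ^ (p / 2) * (s i + X ^ p * v) = 0 := by
      have : (X : (ZMod p)[X]) ^ (p * n) *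
          ((r i + X ^ p * u) + f ^ (p / 2) * (s i + X ^ p * v)) = 0 := by
        rw [← hsum]; ring
      exact (mul_eq_zero.1 this).resolve_left (pow_ne_zero _ X_ne_zero)
    have h2 : (r i + X ^ p * u) ^ 2 * f = f ^ p * (s i + X ^ p * v) ^ 2 := by
      have h5 : f ^ p = (f ^ (p / 2)) ^ 2 * f := by
        rw [← pow_mul, ← pow_succ, mul_comm, hodd]
      rw [eq_neg_of_add_eq_zero_left h1, h5]
      ring
    have h3 : (X : (ZMod p)[X]) ^ p ∣ r i ^ 2 * f - C (f.eval 0) * s i ^ 2 := by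
      obtain ⟨w, hw⟩ := hfp
      refine ⟨w * (s i + X ^ p * v) ^ 2 + C (f.eval 0) * (2 * s i * v + X ^ p * v ^ 2) -
        (2 * r i * u + X ^ p * u ^ 2) * f, ?_⟩
      rw [sub_eq_iff_eq_add] at hw
      rw [hw] at h2
      linear_combination h2
    have h4 : r i ^ 2 * f - C (f.eval 0) * s i ^ 2 = 0 := by
      refine eq_zero_of_dvd_of_natDegree_lt h3 ?_
      rw [natDegree_X_pow]
      have hn : ∀ t : (ZMod p)[X], t.degree < D → 2 * t.natDegree + f.natDegree < p := by
        intro t ht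
        by_cases ht0 : t = 0
        · subst ht0
          simp; omega
        · have := (natDegree_lt_iff_degree_lt ht0).2 ht
          omega
      have h5 := natDegree_mul_le (p := r i ^ 2) (q := f)
      have h6 := natDegree_pow_le (p := r i) (n := 2)
      have h7 := natDegree_C_mul_le (f.eval 0) (s i ^ 2)
      have h8 := natDegree_pow_le (p := s i) (n := 2)
      have h9 := hn _ (hr i)
      have h10 := hn _ (hs i)
      exact lt_of_le_of_lt (natDegree_sub_le _ _) (max_lt (by omega) (by omega))
    exact sq_mul_ne_C_mul_sq hf h0 (sub_eq_zero.1 h4)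

theorem exists_stepanov_coeffs (f : (ZMod p)[X]) (l h J D : ℕ) (a : ZMod p)
    (hdim : l * (D + l * f.natDegree + J) < 2 * J * D) :
    ∃ r s : Fin J → (ZMod p)[X], (∀ j, (r j).degree < D) ∧ (∀ j, (s j).degree < D) ∧
      ¬ (r = 0 ∧ s = 0) ∧ ∀ k < l, ∑ j : Fin J, (stepanovIter f l k (r j) +
        C a * stepanovIter f (l + h) k (s j)) * X ^ (j : ℕ) = 0 := by
  let V := (Fin J → degreeLT (ZMod p) D) × (Fin J → degreeLT (ZMod p) D)
  let M := D + l * f.natDegree + J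
  let Ψ : Fin l → V →ₗ[ZMod p] (ZMod p)[X] := fun k => ∑ j : Fin J,
    LinearMap.mulLeft (ZMod p) (X ^ (j : ℕ)) ∘ₗ
      (stepanovIter f l k ∘ₗ (degreeLT (ZMod p) D).subtype ∘ₗ LinearMap.proj j ∘ₗ
          LinearMap.fst (ZMod p) _ _ +
        LinearMap.mulLeft (ZMod p) (C a) ∘ₗ stepanovIter f (l + h) k ∘ₗ
          (degreeLT (ZMod p) D).subtype ∘ₗ LinearMap.proj j ∘ₗ LinearMap.snd (ZMod p) _ _)
  have hΨ : ∀ k v, Ψ k v = ∑ j : Fin J, (stepanovIter f l k (v.1 j) +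
        C a * stepanovIter f (l + h) k (v.2 j)) * X ^ (j : ℕ) := by
    intro k v
    simp [Ψ, LinearMap.sum_apply, mul_comm]
    rfl
  let Φ : V →ₗ[ZMod p] (Fin l → Fin M → ZMod p) :=
    LinearMap.pi fun k => LinearMap.pi fun i => lcoeff (ZMod p) i ∘ₗ Ψ k
  have hlt : Module.finrank (ZMod p) (Fin l → Fin M → ZMod p) < Module.finrank (ZMod p) V := by
    have h1 : Module.finrank (ZMod p) (degreeLT (ZMod p) D) = D := by
      rw [(degreeLTEquiv (ZMod p) D).finrank_eq]; simp
    simp only [V, Module.finrank_prod, Module.finrank_pi_fintype, h1, Module.finrank_self,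
      sum_const, card_univ, Fintype.card_fin, smul_eq_mul, mul_one, M]
    linarith
  have : Module.Finite (ZMod p) (degreeLT (ZMod p) D) :=
    Module.Finite.equiv (degreeLTEquiv (ZMod p) D).symm
  obtain ⟨v, hv, hv0⟩ := (Submodule.ne_bot_iff _).1 (Φ.ker_ne_bot_of_finrank_lt hlt)
  refine ⟨fun j => v.1 j, fun j => v.2 j, fun j => mem_degreeLT.1 (v.1 j).2,
    fun j => mem_degreeLT.1 (v.2 j).2, fun ⟨h1, h2⟩ => hv0 ?_, fun k hk => ?_⟩
  · exact Prod.ext (funext fun j => Subtype.ext (congrFun h1 j))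
      (funext fun j => Subtype.ext (congrFun h2 j))
  · ext i
    rw [← hΨ ⟨k, hk⟩ v, coeff_zero]
    by_cases hi : i < M
    · exact congrFun (congrFun (LinearMap.mem_ker.1 hv) ⟨k, hk⟩) ⟨i, hi⟩
    · refine coeff_eq_zero_of_degree_lt (lt_of_lt_of_le ?_ (Nat.cast_le.2 (not_lt.1 hi)))
      rw [hΨ]
      have hkl : k * f.natDegree ≤ l * f.natDegree := Nat.mul_le_mul_right _ hk.le
      rw [← mem_degreeLT]
      refine Submodule.sum_mem _ fun j _ => ?_
      rw [mem_degreeLT]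
      have key : ∀ e, ∀ t : degreeLT (ZMod p) D,
          stepanovIter f e k t ∈ degreeLT (ZMod p) (D + k * f.natDegree) := fun e t =>
        mem_degreeLT.2 (degree_stepanovIter_lt f t e k D (mem_degreeLT.1 t.2))
      have h3 : stepanovIter f l k (v.1 j) + C a * stepanovIter f (l + h) k (v.2 j) ∈
          degreeLT (ZMod p) (D + k * f.natDegree) := by
        rw [← smul_eq_C_mul]
        exact add_mem (key _ _) (Submodule.smul_mem _ _ (key _ _))
      rw [mem_degreeLT] at h3
      rw [degree_mul, degree_X_pow]
      refine lt_of_lt_of_le (WithBot.add_lt_add_right (by simp) h3) ?_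
      have := j.2
      exact_mod_cast (by omega)

/-- **Stepanov's bound** for the number of points where `f ^ ((p - 1) / 2)` takes a given value. -/
theorem stepanov_bound (hp : p ≠ 2) (f : (ZMod p)[X]) (h0 : f.eval 0 ≠ 0) (x : ZMod p)
    (hf : Odd (f.rootMultiplicity x)) (l J D : ℕ) (hl : l ≤ p) (hD0 : 0 < D)
    (hD : 2 * D + f.natDegree ≤ p) (hdim : l * (D + l * f.natDegree + J) < 2 * J * D)
    (a : ZMod p) :
    l * #{y : ZMod p | f.eval y ^ (p / 2) = a} ≤ (l + p / 2) * f.natDegree + D + p * J := by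
  have hpp : p.Prime := Fact.out
  obtain ⟨r, s, hr, hs, hrs, hk⟩ := exists_stepanov_coeffs f l (p / 2) J D a hdim
  have hF : stepanovPoly f l (p / 2) r s ≠ 0 := fun h =>
    hrs (stepanovPoly_ne_zero hp f h0 x hf l D hD0 hD r s hr hs h)
  have hdeg : ∀ t : (ZMod p)[X], t.degree < D → t.natDegree ≤ D := fun t ht =>
    natDegree_le_iff_degree_le.2 ht.le
  refine le_trans ?_ (natDegree_stepanovPoly_le f l (p / 2) D r s (fun j => hdeg _ (hr j))
    fun j => hdeg _ (hs j))
  refine le_trans ?_ (card_roots' _)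
  have hmult : ∀ y ∈ ({y : ZMod p | f.eval y ^ (p / 2) = a} : Finset (ZMod p)),
      l ≤ (stepanovPoly f l (p / 2) r s).roots.count y := by
    intro y hy
    rw [mem_filter] at hy
    rw [count_roots]
    rcases Nat.eq_zero_or_pos l with rfl | hlpos
    · exact Nat.zero_le _
    have := lt_rootMultiplicity_of_isRoot_iterate_derivative_of_mem_nonZeroDivisors'
      (t := y) (n := l - 1) hF (fun m hm => by
        rw [IsRoot, eval_iterate_derivative_stepanovPoly f l _ r s m (by omega) a y hy.2,
          hk m (by omega), eval_zero, mul_zero]) (fun m hm hm0 => by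
        rw [mem_nonZeroDivisors_iff_ne_zero, Ne, ZMod.natCast_eq_zero_iff]
        exact fun hdvd => by have := Nat.le_of_dvd (Nat.pos_of_ne_zero hm0) hdvd; omega)
    omega
  calc l * #{y : ZMod p | f.eval y ^ (p / 2) = a}
      = ∑ y ∈ ({y : ZMod p | f.eval y ^ (p / 2) = a} : Finset (ZMod p)), l := by
        rw [sum_const, smul_eq_mul, mul_comm]
    _ ≤ ∑ y ∈ ({y : ZMod p | f.eval y ^ (p / 2) = a} : Finset (ZMod p)),
          (stepanovPoly f l (p / 2) r s).roots.count y := sum_le_sum hmult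
    _ ≤ ∑ y ∈ (stepanovPoly f l (p / 2) r s).roots.toFinset ∪
          ({y : ZMod p | f.eval y ^ (p / 2) = a} : Finset (ZMod p)),
          (stepanovPoly f l (p / 2) r s).roots.count y :=
        sum_le_sum_of_subset subset_union_right
    _ = Multiset.card (stepanovPoly f l (p / 2) r s).roots :=
        Multiset.sum_count_eq_card fun y hy =>
          mem_union_left _ (Multiset.mem_toFinset.2 hy)

end Stepanov

section CharacterSum

open Polynomial

theorem sum_quadraticChar_eval_le {p : ℕ} [Fact p.Prime] (hp : p ≠ 2) (f : (ZMod p)[X])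
    (h0 : f.eval 0 ≠ 0) (x : ZMod p) (hf : Odd (f.rootMultiplicity x)) (n : ℕ) (hn : 0 < n)
    (hnp : 2 * (n * (2 * n * f.natDegree + n + 1)) + f.natDegree + 1 < p) :
    n * |∑ y : ZMod p, quadraticChar (ZMod p) (f.eval y)| ≤
      3 * n * f.natDegree + p * (f.natDegree + 2) := by
  have hpp : p.Prime := Fact.out
  set m := f.natDegree with hm
  have hf0 : f ≠ 0 := by rintro rfl; simp at h0
  have hchar : ringChar (ZMod p) ≠ 2 := by rwa [ZMod.ringChar_zmod_n]
  have hcard : Fintype.card (ZMod p) = p := ZMod.card p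
  have hne : (1 : ZMod p) ≠ -1 := by
    intro h
    exact Ring.neg_one_ne_one_of_char_ne_two hchar h.symm
  have hbound : ∀ a : ZMod p, 2 * n * (#{y : ZMod p | f.eval y ^ (p / 2) = a} : ℤ) ≤
      2 * n * m + p * (m + 2) + n * p := by
    intro a
    have hd : n * (2 * n * m + n + 1) < (p - m) / 2 := by omega
    have hnp2 : 2 * n ≤ p := by nlinarith [Nat.zero_le (n * n * m), Nat.zero_le (n * n)]
    have := stepanov_bound hp f h0 x hf (2 * n) (n + 1) ((p - m) / 2) hnp2 (by omega)
      (by omega) (by nlinarith) a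
    have h2 : (p / 2) * m ≤ p * m := Nat.mul_le_mul_right _ (Nat.div_le_self _ _)
    have h3 : (p - m) / 2 ≤ p := by omega
    have h4 : 2 * n * #{y : ZMod p | f.eval y ^ (p / 2) = a} ≤
      2 * n * m + p * (m + 2) + n * p := by nlinarith
    exact_mod_cast h4
  have hpow : ∀ y : ZMod p, ((quadraticChar (ZMod p) (f.eval y) : ℤ) : ZMod p) =
      f.eval y ^ (p / 2) := by
    intro y
    rw [quadraticChar_eq_pow_of_char_ne_two' hchar, hcard]
  have hval : ∀ y : ZMod p, quadraticChar (ZMod p) (f.eval y) =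
      (if f.eval y ^ (p / 2) = 1 then 1 else 0) - (if f.eval y ^ (p / 2) = -1 then 1 else 0) ∧
      (if f.eval y ^ (p / 2) = 1 then 1 else 0) + (if f.eval y ^ (p / 2) = -1 then 1 else 0) +
        (if f.eval y = 0 then 1 else 0) = (1 : ℤ) := by
    intro y
    by_cases hy : f.eval y = 0
    · have : p / 2 ≠ 0 := by have := hpp.two_le; omega
      simp [hy, this]
    · rw [← hpow]
      rcases quadraticChar_dichotomy hy with h | h <;> simp [h, hy, hne, hne.symm]
  have hroots : (#{y : ZMod p | f.eval y = 0} : ℤ) ≤ m := by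
    have h1 : ({y : ZMod p | f.eval y = 0} : Finset (ZMod p)) ⊆ f.roots.toFinset := by
      intro y hy
      rw [mem_filter] at hy
      simp [hf0, hy.2]
    have := (card_le_card h1).trans ((Multiset.toFinset_card_le _).trans (card_roots' f))
    exact_mod_cast this
  have hA : ∑ y : ZMod p, quadraticChar (ZMod p) (f.eval y) =
      (#{y : ZMod p | f.eval y ^ (p / 2) = 1} : ℤ) - #{y : ZMod p | f.eval y ^ (p / 2) = -1} := by
    rw [sum_congr rfl fun y _ => (hval y).1, sum_sub_distrib, sum_boole, sum_boole]
  have hB : (#{y : ZMod p | f.eval y ^ (p / 2) = 1} : ℤ) +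
      #{y : ZMod p | f.eval y ^ (p / 2) = -1} + #{y : ZMod p | f.eval y = 0} = p := by
    have := sum_congr rfl fun y (_ : y ∈ univ) => (hval y).2
    rw [sum_add_distrib, sum_add_distrib, sum_boole, sum_boole, sum_boole] at this
    simpa [hcard] using this
  have h1 := hbound 1
  have h2 := hbound (-1)
  rw [hA]
  have hn' : (0 : ℤ) < n := by exact_mod_cast hn
  rcases abs_cases ((#{y : ZMod p | f.eval y ^ (p / 2) = 1} : ℤ) -
    #{y : ZMod p | f.eval y ^ (p / 2) = -1}) with ⟨h, _⟩ | ⟨h, _⟩ <;> rw [h] <;> nlinarith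

/-- Sums of the quadratic character over the values of a polynomial of bounded degree that has
a root of odd multiplicity are `o(p)`. -/
theorem exists_forall_sum_quadraticChar_le (m : ℕ) {ε : ℝ} (hε : 0 < ε) :
    ∃ P : ℕ, ∀ (p : ℕ) [Fact p.Prime], P ≤ p → ∀ f : (ZMod p)[X], f.natDegree = m →
      f.eval 0 ≠ 0 → ∀ x, Odd (f.rootMultiplicity x) →
      |((∑ y : ZMod p, quadraticChar (ZMod p) (f.eval y) : ℤ) : ℝ)| ≤ ε * p := by
  obtain ⟨n, hn⟩ := exists_nat_gt (2 * (m + 2) / ε)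
  have hn0 : (0 : ℝ) < n := lt_of_le_of_lt (by positivity) hn
  obtain ⟨P, hP⟩ := exists_nat_gt (6 * m / ε)
  refine ⟨P + 3 + 2 * (n * (2 * n * m + n + 1)) + m + 1, fun p _ hp f hf h0 x hx => ?_⟩
  have h := sum_quadraticChar_eval_le (by omega) f h0 x hx n (by exact_mod_cast hn0)
    (by rw [hf]; omega)
  rw [hf] at h
  have h' : (n : ℝ) * |((∑ y : ZMod p, quadraticChar (ZMod p) (f.eval y) : ℤ) : ℝ)| ≤
      3 * n * m + p * (m + 2) := by exact_mod_cast h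
  have hPp : (P : ℝ) ≤ p := by exact_mod_cast (by omega : P ≤ p)
  have hp0 : (0 : ℝ) ≤ p := by positivity
  rw [div_lt_iff₀ hε] at hn hP
  have h1 : (6 * m : ℝ) ≤ p * ε := hP.le.trans (mul_le_mul_of_nonneg_right hPp hε.le)
  refine le_of_mul_le_mul_left (h'.trans ?_) hn0
  nlinarith

end CharacterSum

section SquareCount

open Polynomial

variable {p : ℕ} [Fact p.Prime] {ι : Type*}

theorem natDegree_prod_X_sq_sub (s : Finset ι) (b : ι → ZMod p) :
    (∏ i ∈ s, (X ^ 2 - C (4 * b i ^ 2)) : (ZMod p)[X]).natDegree = 2 * #s := by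
  rw [natDegree_prod_of_monic _ _ fun i _ => monic_X_pow_sub_C _ two_ne_zero]
  rw [sum_congr rfl fun i _ => natDegree_X_pow_sub_C]
  simp [mul_comm]

theorem odd_rootMultiplicity_prod_X_sq_sub [DecidableEq ι] (hp : p ≠ 2) (s : Finset ι)
    (b : ι → ZMod p)
    (hb : ∀ i, b i ≠ 0) (hdist : ∀ i j, i ≠ j → b i ≠ b j ∧ b i ≠ -b j) {i : ι} (hi : i ∈ s) :
    Odd ((∏ i ∈ s, (X ^ 2 - C (4 * b i ^ 2)) : (ZMod p)[X]).rootMultiplicity (2 * b i)) := by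
  have h2 : (2 : ZMod p) ≠ 0 := by
    exact Ring.two_ne_zero (by rwa [ZMod.ringChar_zmod_n])
  have hne : (∏ i ∈ s, (X ^ 2 - C (4 * b i ^ 2)) : (ZMod p)[X]) ≠ 0 :=
    (monic_prod_of_monic _ _ fun i _ => monic_X_pow_sub_C _ two_ne_zero).ne_zero
  have hfac : (∏ i ∈ s, (X ^ 2 - C (4 * b i ^ 2)) : (ZMod p)[X]) = (X - C (2 * b i)) *
      ((X + C (2 * b i)) * ∏ j ∈ s.erase i, (X ^ 2 - C (4 * b j ^ 2))) := by
    rw [← mul_prod_erase s _ hi, ← mul_assoc]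
    congr 1
    simp only [map_mul, map_pow, C_ofNat]
    ring
  have hz : ((X + C (2 * b i)) * ∏ j ∈ s.erase i, (X ^ 2 - C (4 * b j ^ 2)) :
      (ZMod p)[X]).eval (2 * b i) ≠ 0 := by
    rw [eval_mul, eval_prod]
    refine mul_ne_zero ?_ (prod_ne_zero_iff.2 fun j hj => ?_)
    · have : 2 * b i + 2 * b i = 2 * 2 * b i := by ring
      simp only [eval_add, eval_X, eval_C, this]
      exact mul_ne_zero (mul_ne_zero h2 h2) (hb i)
    · have : (2 * b i) ^ 2 - 4 * b j ^ 2 = 2 * 2 * ((b i - b j) * (b i + b j)) := by ring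
      simp only [eval_sub, eval_pow, eval_X, eval_C, this]
      have hd := hdist i j (ne_of_mem_erase hj).symm
      exact mul_ne_zero (mul_ne_zero h2 h2) (mul_ne_zero (sub_ne_zero.2 hd.1)
        fun h => hd.2 (eq_neg_of_add_eq_zero_left h))
  rw [hfac] at hne ⊢
  rw [rootMultiplicity_mul hne, rootMultiplicity_X_sub_C_self, rootMultiplicity_eq_zero hz]
  exact odd_one

/-- The quadratic residue conditions on `c ^ 2 - 4 b i ^ 2` are asymptotically independent. -/
theorem exists_forall_card_quadraticChar_eq_one (r : ℕ) {ε : ℝ} (hε : 0 < ε) :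
    ∃ P : ℕ, ∀ (p : ℕ) [Fact p.Prime], P ≤ p → ∀ b : Fin r → ZMod p, (∀ i, b i ≠ 0) →
      (∀ i j, i ≠ j → b i ≠ b j ∧ b i ≠ -b j) → ∀ s : Finset (Fin r),
      |(#{c : ZMod p | ∀ i ∈ s, quadraticChar (ZMod p) (c ^ 2 - 4 * b i ^ 2) = 1} : ℝ) -
        p / 2 ^ #s| ≤ ε * p := by
  set δ : ℝ := ε / 2 / 2 ^ r with hδ
  have hδ0 : 0 < δ := by positivity
  choose P hP using fun m : ℕ => exists_forall_sum_quadraticChar_le (2 * m) hδ0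
  obtain ⟨Q, hQ⟩ := exists_nat_gt (4 * r / ε)
  refine ⟨3 + Q + ∑ m ∈ range (r + 1), P m, fun p _ hp b hb hdist s => ?_⟩
  have hpp : p.Prime := Fact.out
  have hp2 : p ≠ 2 := by omega
  have hcard : Fintype.card (ZMod p) = p := ZMod.card p
  have h2 : (2 : ZMod p) ≠ 0 := by
    exact Ring.two_ne_zero (by rwa [ZMod.ringChar_zmod_n])
  let η : ZMod p → Fin r → ℝ := fun c i => ((quadraticChar (ZMod p) (c ^ 2 - 4 * b i ^ 2) : ℤ) : ℝ)
  have hsr : #s ≤ r := by simpa using card_le_univ s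
  have hsum : |∑ c : ZMod p, ∏ i ∈ s, (1 + η c i) - p| ≤ 2 ^ #s * (δ * p) := by
    have h1 : ∑ c : ZMod p, ∏ i ∈ s, (1 + η c i) =
        ∑ t ∈ s.powerset, ∑ c : ZMod p, ∏ i ∈ t, η c i := by
      simp_rw [prod_one_add]
      rw [sum_comm]
    have h3 : ∑ t ∈ s.powerset, ∑ c : ZMod p, ∏ i ∈ t, η c i - p =
        ∑ t ∈ s.powerset.erase ∅, ∑ c : ZMod p, ∏ i ∈ t, η c i := by
      rw [← add_sum_erase _ _ (empty_mem_powerset s)]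
      simp
    rw [h1, h3]
    refine (abs_sum_le_sum_abs _ _).trans ?_
    refine (sum_le_card_nsmul _ _ (δ * p) fun t ht => ?_).trans ?_
    · obtain ⟨hte, hts⟩ := mem_erase.1 ht
      obtain ⟨i, hi⟩ := nonempty_iff_ne_empty.2 hte
      have htr : #t < r + 1 := Nat.lt_succ_of_le ((card_le_card (mem_powerset.1 hts)).trans hsr)
      have hPp : P #t ≤ p := by
        have := single_le_sum (fun m _ => Nat.zero_le (P m)) (mem_range.2 htr)
        omega
      have h0 : (∏ i ∈ t, (X ^ 2 - C (4 * b i ^ 2)) : (ZMod p)[X]).eval 0 ≠ 0 := by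
        rw [eval_prod]
        refine prod_ne_zero_iff.2 fun j _ => ?_
        have : (0 : ZMod p) ^ 2 - 4 * b j ^ 2 = -((2 * b j) ^ 2) := by ring
        simp only [eval_sub, eval_pow, eval_X, eval_C, this]
        exact neg_ne_zero.2 (pow_ne_zero _ (mul_ne_zero h2 (hb j)))
      have := hP #t p hPp _ (natDegree_prod_X_sq_sub t b) h0 _
        (odd_rootMultiplicity_prod_X_sq_sub hp2 t b hb hdist hi)
      simpa [eval_prod, map_prod, η] using this
    · rw [nsmul_eq_mul]
      refine mul_le_mul_of_nonneg_right ?_ (by positivity)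
      have := (card_erase_le (s := s.powerset) (a := ∅)).trans (card_powerset s).le
      exact_mod_cast this
  have hη : ∀ c i, 0 ≤ 1 + η c i ∧ 1 + η c i ≤ 2 := by
    intro c i
    by_cases h : c ^ 2 - 4 * b i ^ 2 = 0
    · simp [η, h]
    · rcases quadraticChar_dichotomy h with h | h <;> simp only [η, h] <;> norm_num
  let D : Finset (ZMod p) := univ.biUnion fun i : Fin r => {2 * b i, -(2 * b i)}
  have hD : (#D : ℝ) ≤ 2 * r := by
    have h1 : #D ≤ ∑ i : Fin r, #({2 * b i, -(2 * b i)} : Finset (ZMod p)) := card_biUnion_le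
    have h3 : ∑ i : Fin r, #({2 * b i, -(2 * b i)} : Finset (ZMod p)) ≤ 2 * r := by
      refine (sum_le_card_nsmul _ _ 2 fun i _ => card_le_two).trans ?_
      simp [mul_comm]
    exact_mod_cast h1.trans h3
  have hcmp : |2 ^ #s * (#{c : ZMod p | ∀ i ∈ s,
      quadraticChar (ZMod p) (c ^ 2 - 4 * b i ^ 2) = 1} : ℝ) -
      ∑ c : ZMod p, ∏ i ∈ s, (1 + η c i)| ≤ 2 ^ #s * (2 * r) := by
    have h1 : (#{c : ZMod p | ∀ i ∈ s, quadraticChar (ZMod p) (c ^ 2 - 4 * b i ^ 2) = 1} : ℝ) =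
        ∑ c : ZMod p, if ∀ i ∈ s, quadraticChar (ZMod p) (c ^ 2 - 4 * b i ^ 2) = 1
          then (1 : ℝ) else 0 := by rw [sum_boole]
    rw [h1, mul_sum, ← sum_sub_distrib]
    refine (abs_sum_le_sum_abs _ _).trans ?_
    have h3 : ∀ c : ZMod p, |2 ^ #s * (if ∀ i ∈ s, quadraticChar (ZMod p) (c ^ 2 - 4 * b i ^ 2) = 1
          then (1 : ℝ) else 0) - ∏ i ∈ s, (1 + η c i)| ≤ if c ∈ D then 2 ^ #s else 0 := by
      intro c
      have hle : ∏ i ∈ s, (1 + η c i) ≤ 2 ^ #s :=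
        (prod_le_prod (fun i _ => (hη c i).1) fun i _ => (hη c i).2).trans (by simp)
      have hge : 0 ≤ ∏ i ∈ s, (1 + η c i) := prod_nonneg fun i _ => (hη c i).1
      split_ifs with hall hcD hcD
      · rw [mul_one, abs_of_nonneg (by linarith)]; linarith
      · have : ∏ i ∈ s, (1 + η c i) = 2 ^ #s := by
          rw [prod_congr rfl (g := fun _ => (2 : ℝ)) fun i hi => by
            simp only [η, hall i hi]; norm_num]
          simp
        simp [this]
      · rw [mul_zero, zero_sub, abs_neg, abs_of_nonneg hge]; exact hle
      · push Not at hall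
        obtain ⟨i, hi, hne⟩ := hall
        have h0 : c ^ 2 - 4 * b i ^ 2 ≠ 0 := by
          intro h0
          apply hcD
          have : (c - 2 * b i) * (c + 2 * b i) = 0 := by linear_combination h0
          refine mem_biUnion.2 ⟨i, mem_univ _, ?_⟩
          rcases mul_eq_zero.1 this with h | h
          · simp [sub_eq_zero.1 h]
          · simp [eq_neg_of_add_eq_zero_left h]
        have h1 : 1 + η c i = 0 := by
          simp only [η, (quadraticChar_dichotomy h0).resolve_left hne]; norm_num
        rw [prod_eq_zero hi h1]; simp
    refine (sum_le_sum fun c _ => h3 c).trans ?_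
    rw [← sum_filter, sum_const, nsmul_eq_mul, mul_comm]
    simp only [filter_mem_eq_inter, univ_inter]
    exact mul_le_mul_of_nonneg_left hD (by positivity)
  have hpow : (2 : ℝ) ^ #s ≤ 2 ^ r := pow_le_pow_right₀ (by norm_num) hsr
  have h2s : (0 : ℝ) < 2 ^ #s := by positivity
  have hQp : (Q : ℝ) ≤ p := by exact_mod_cast (by omega : Q ≤ p)
  rw [div_lt_iff₀ hε] at hQ
  have h4r : 4 * (r : ℝ) ≤ ε * p := by nlinarith
  have hδp : δ * p ≤ ε / 2 * p := by
    refine mul_le_mul_of_nonneg_right ?_ (by positivity)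
    rw [hδ]
    exact div_le_self (by positivity) (one_le_pow₀ (by norm_num))
  have hfin := (abs_sub_le _ _ _).trans (add_le_add hcmp hsum)
  have hrw : (2 : ℝ) ^ #s * (#{c : ZMod p | ∀ i ∈ s,
      quadraticChar (ZMod p) (c ^ 2 - 4 * b i ^ 2) = 1} : ℝ) - p =
      2 ^ #s * ((#{c : ZMod p | ∀ i ∈ s,
        quadraticChar (ZMod p) (c ^ 2 - 4 * b i ^ 2) = 1} : ℝ) - p / 2 ^ #s) := by
    field_simp
  rw [hrw, abs_mul, abs_of_pos h2s, ← mul_add] at hfin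
  have := le_of_mul_le_mul_left hfin h2s
  linarith

end SquareCount

section Elimination

open Polynomial

theorem exists_eq_mul_add_linear {B : Type*} [CommRing B] (s w : B) (G : B[X]) :
    ∃ (Q : B[X]) (u v : B), G = (X ^ 2 + C s * X + C w) * Q + (C u + C v * X) := by
  nontriviality B
  have hm : (X ^ 2 + C s * X + C w : B[X]).Monic := by monicity!
  have hd : (X ^ 2 + C s * X + C w : B[X]).natDegree = 2 := by compute_degree!
  have hlt := natDegree_modByMonic_lt G hm (fun h => by rw [h] at hd; simp at hd)
  rw [hd] at hlt
  have hdiv := modByMonic_add_div G (X ^ 2 + C s * X + C w)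
  generalize G %ₘ (X ^ 2 + C s * X + C w) = R at hlt hdiv
  generalize G /ₘ (X ^ 2 + C s * X + C w) = Q at hdiv
  have hR := eq_X_add_C_of_natDegree_le_one (Nat.lt_succ_iff.1 hlt)
  refine ⟨Q, R.coeff 0, R.coeff 1, ?_⟩
  rw [← hdiv]
  linear_combination hR

/-- Elimination of a variable subject to a monic quadratic equation. -/
theorem exists_norm_quadratic {B : Type*} [CommRing B] (s w : B) (G : B[X]) :
    ∃ N : B, (∀ (K : Type) [Field K] (φ : B →+* K) (y : K), y ^ 2 + φ s * y + φ w = 0 →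
        eval₂ φ y G = 0 → φ N = 0) ∧
      ∀ (K : Type) [Field K] [IsAlgClosed K] (φ : B →+* K), φ N = 0 →
        ∃ y : K, y ^ 2 + φ s * y + φ w = 0 ∧ eval₂ φ y G = 0 := by
  obtain ⟨Q, u, v, hG⟩ := exists_eq_mul_add_linear s w G
  have hev : ∀ (K : Type) [Field K] (φ : B →+* K) (y : K), y ^ 2 + φ s * y + φ w = 0 →
      eval₂ φ y G = φ u + φ v * y := by
    intro K _ φ y hy
    rw [hG]
    simp [eval₂_add, eval₂_mul, hy]
  refine ⟨u ^ 2 - u * v * s + v ^ 2 * w, fun K _ φ y hy h0 => ?_, fun K _ _ φ hN => ?_⟩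
  · rw [hev K φ y hy] at h0
    simp only [map_add, map_sub, map_mul, map_pow]
    linear_combination (φ u - φ v * (φ s + y)) * h0 + φ v ^ 2 * hy
  · obtain ⟨y, hy⟩ := IsAlgClosed.exists_root (X ^ 2 + C (φ s) * X + C (φ w) : K[X]) (by
      have : (X ^ 2 + C (φ s) * X + C (φ w) : K[X]).natDegree = 2 := by compute_degree!
      intro h
      rw [degree_eq_natDegree (fun h0 => by rw [h0] at this; simp at this), this] at h
      norm_num at h)
    have hy : y ^ 2 + φ s * y + φ w = 0 := by simpa using hy
    have hy' : (-φ s - y) ^ 2 + φ s * (-φ s - y) + φ w = 0 := by linear_combination hy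
    simp only [map_add, map_sub, map_mul, map_pow] at hN
    have : (φ u + φ v * y) * (φ u + φ v * (-φ s - y)) = 0 := by
      linear_combination hN - φ v ^ 2 * hy
    rcases mul_eq_zero.1 this with h | h
    · exact ⟨y, hy, by rw [hev K φ y hy, h]⟩
    · exact ⟨_, hy', by rw [hev K φ _ hy', h]⟩

theorem exists_norm_quadratics {A : Type*} [CommRing A] (n : ℕ) (t w : Fin n → A)
    (F : MvPolynomial (Fin n) A) :
    ∃ N : A, (∀ (K : Type) [Field K] (φ : A →+* K) (x : Fin n → K),
        (∀ i, x i ^ 2 + φ (t i) * x i + φ (w i) = 0) → MvPolynomial.eval₂ φ x F = 0 → φ N = 0) ∧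
      ∀ (K : Type) [Field K] [IsAlgClosed K] (φ : A →+* K), φ N = 0 →
        ∃ x : Fin n → K, (∀ i, x i ^ 2 + φ (t i) * x i + φ (w i) = 0) ∧
          MvPolynomial.eval₂ φ x F = 0 := by
  induction n with
  | zero =>
    have h : ∀ (K : Type) [Field K] (φ : A →+* K) (x : Fin 0 → K),
        MvPolynomial.eval₂ φ x F = φ (MvPolynomial.isEmptyRingEquiv A (Fin 0) F) := by
      intro K _ φ x
      conv_lhs => rw [MvPolynomial.eq_C_of_isEmpty F]
      rw [MvPolynomial.eval₂_C]
      rfl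
    refine ⟨MvPolynomial.isEmptyRingEquiv A (Fin 0) F, fun K _ φ x _ hx => ?_,
      fun K _ _ φ hN => ⟨Fin.elim0, fun i => i.elim0, ?_⟩⟩
    · rwa [← h K φ x]
    · rwa [h K φ]
  | succ n ih =>
    obtain ⟨N', h1, h2⟩ := exists_norm_quadratic (MvPolynomial.C (t 0) : MvPolynomial (Fin n) A)
      (MvPolynomial.C (w 0)) (MvPolynomial.finSuccEquiv A n F)
    obtain ⟨N, h3, h4⟩ := ih (fun i => t i.succ) (fun i => w i.succ) N'
    have hev : ∀ (K : Type) [Field K] (φ : A →+* K) (y : K) (x : Fin n → K),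
        MvPolynomial.eval₂ φ (Fin.cons y x) F =
          eval₂ (MvPolynomial.eval₂Hom φ x) y (MvPolynomial.finSuccEquiv A n F) := by
      intro K _ φ y x
      have : MvPolynomial.eval₂Hom φ (Fin.cons y x : Fin (n + 1) → K) =
          (eval₂RingHom (MvPolynomial.eval₂Hom φ x) y).comp
            (MvPolynomial.finSuccEquiv A n).toRingEquiv.toRingHom := by
        refine MvPolynomial.ringHom_ext (fun a => ?_) fun i => ?_
        · simp [MvPolynomial.finSuccEquiv_apply]
        · refine Fin.cases ?_ (fun i => ?_) i <;> simp [MvPolynomial.finSuccEquiv_apply]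
      exact congrArg (fun g => g F) this
    refine ⟨N, fun K _ φ x hx hF => ?_, fun K _ _ φ hN => ?_⟩
    · refine h3 K φ (fun i => x i.succ) (fun i => hx i.succ) ?_
      refine h1 K (MvPolynomial.eval₂Hom φ fun i => x i.succ) (x 0) (by simpa using hx 0) ?_
      rw [← hev]
      convert hF
      exact Fin.cons_self_tail x
    · obtain ⟨x, hx, hx0⟩ := h4 K φ hN
      obtain ⟨y, hy, hy0⟩ := h2 K (MvPolynomial.eval₂Hom φ x) hx0
      refine ⟨Fin.cons y x, fun i => ?_, by rw [hev, hy0]⟩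
      refine Fin.cases ?_ (fun i => ?_) i
      · simpa using hy
      · simpa using hx i

theorem normSq_eq_of_quadratic {x : ℂ} {c a : ℝ} (h : x ^ 2 + c * x + a ^ 2 = 0)
    (hc : c ^ 2 < 4 * a ^ 2) : normSq x = a ^ 2 := by
  have hre := congrArg Complex.re h
  have him := congrArg Complex.im h
  simp [sq] at hre him
  rw [normSq_apply]
  have h2 : x.im * (2 * x.re + c) = 0 := by linarith
  rcases mul_eq_zero.1 h2 with h2 | h2
  · rw [h2] at hre
    nlinarith [sq_nonneg (2 * x.re + c)]
  · have : c = -2 * x.re := by linarith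
    subst this
    nlinarith

theorem normSq_ne_of_quadratic {x : ℂ} {c a : ℝ} (h : x ^ 2 + c * x + a ^ 2 = 0)
    (ha : a ≠ 0)
    (hc : 4 * a ^ 2 < c ^ 2) : normSq x ≠ a ^ 2 := by
  intro hn
  have hre := congrArg Complex.re h
  have him := congrArg Complex.im h
  simp [sq] at hre him
  rw [normSq_apply] at hn
  have h2 : x.im * (2 * x.re + c) = 0 := by linarith
  rcases mul_eq_zero.1 h2 with h2 | h2
  · rw [h2] at hre hn
    have h3 : x.re * (2 * x.re + c) = 0 := by nlinarith
    rcases mul_eq_zero.1 h3 with h3 | h3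
    · rw [h3] at hre
      exact ha (by nlinarith)
    · have : c = -2 * x.re := by linarith
      subst this
      nlinarith
  · have : c = -2 * x.re := by linarith
    subst this
    nlinarith [mul_self_nonneg x.im]

/-- A polynomial in `c` vanishing whenever the roots of `a i (y ^ 2 + 1) + c y` satisfy a given
multiplicative relation. -/
theorem exists_polynomial_of_multiplicative_relation {r : ℕ} (a : Fin r → ℤ) (ha : ∀ i, a i ≠ 0)
    (hdist : ∀ i j, i ≠ j → a i ≠ a j ∧ a i ≠ -a j) (m : Fin r → ℤ) (hm : m ≠ 0) :
    ∃ N : ℤ[X], N ≠ 0 ∧ ∀ (K : Type) [Field K] (c : K) (y : Fin r → K),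
      (∀ i, (a i : K) ≠ 0) → (∀ i, y i ≠ 0) → (∀ i, a i * (y i ^ 2 + 1) + c * y i = 0) →
      ∏ i, y i ^ m i = 1 → eval₂ (Int.castRingHom K) c N = 0 := by
  obtain ⟨N, h1, h2⟩ := exists_norm_quadratics r (fun _ => (X : ℤ[X]))
    (fun i => C (a i ^ 2))
    (∏ i, (MvPolynomial.C (C (a i ^ (-m i).toNat)) * MvPolynomial.X i ^ (m i).toNat) -
      ∏ i, (MvPolynomial.C (C (a i ^ (m i).toNat)) * MvPolynomial.X i ^ (-m i).toNat))
  have hev : ∀ (K : Type) [Field K] (φ : ℤ[X] →+* K) (x : Fin r → K),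
      MvPolynomial.eval₂ φ x
        (∏ i, (MvPolynomial.C (C (a i ^ (-m i).toNat)) * MvPolynomial.X i ^ (m i).toNat) -
          ∏ i, (MvPolynomial.C (C (a i ^ (m i).toNat)) * MvPolynomial.X i ^ (-m i).toNat)) =
        ∏ i, (a i : K) ^ (-m i).toNat * x i ^ (m i).toNat -
          ∏ i, (a i : K) ^ (m i).toNat * x i ^ (-m i).toNat := by
    intro K _ φ x
    have hC : ∀ n : ℤ, φ (C n) = n := fun n => eq_intCast (φ.comp C) n
    simp only [MvPolynomial.eval₂_sub, MvPolynomial.eval₂_prod, MvPolynomial.eval₂_mul,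
      MvPolynomial.eval₂_pow, MvPolynomial.eval₂_C, MvPolynomial.eval₂_X, hC, Int.cast_pow]
  refine ⟨N, ?_, fun K _ c y haK hy hroot hrel => ?_⟩
  · rintro rfl
    obtain ⟨i₁, hi₁⟩ : ∃ i, m i ≠ 0 := Function.ne_iff.1 hm
    obtain ⟨i₀, hi₀, hmin⟩ := exists_min_image ({i | m i ≠ 0} : Finset (Fin r))
      (fun i => |a i|) ⟨i₁, by simpa using hi₁⟩
    have hi₀ : m i₀ ≠ 0 := by simpa using hi₀
    set c : ℤ := 2 * |a i₀| + 1 with hc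
    obtain ⟨x, hx, hx0⟩ := h2 ℂ ((Int.castRingHom ℂ).comp (evalRingHom c)) (map_zero _)
    have hx : ∀ i, x i ^ 2 + ((c : ℝ) : ℂ) * x i + ((a i : ℝ) : ℂ) ^ 2 = 0 := by
      intro i
      simpa using hx i
    have hj : ∀ i, i ≠ i₀ → m i ≠ 0 → ‖x i‖ = |(a i : ℝ)| := by
      intro i hi hmi
      have h3 : |a i₀| ≤ |a i| := hmin i (by simpa using hmi)
      have h4 : |a i₀| ≠ |a i| := fun h => by
        rcases abs_eq_abs.1 h with h | h
        · exact (hdist i₀ i hi.symm).1 h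
        · exact (hdist i₀ i hi.symm).2 h
      have h5 : |a i₀| + 1 ≤ |a i| := by omega
      have h6 : c ^ 2 < 4 * a i ^ 2 := by
        rw [← sq_abs (a i)]
        have := abs_nonneg (a i₀)
        nlinarith
      have := normSq_eq_of_quadratic (hx i) (by exact_mod_cast h6)
      rw [normSq_eq_norm_sq, ← sq_abs (a i : ℝ)] at this
      exact (sq_eq_sq₀ (norm_nonneg _) (abs_nonneg _)).1 this
    have hi : ‖x i₀‖ ≠ |(a i₀ : ℝ)| := by
      intro h
      have h6 : 4 * a i₀ ^ 2 < c ^ 2 := by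
        rw [← sq_abs (a i₀)]
        have := abs_nonneg (a i₀)
        nlinarith
      refine normSq_ne_of_quadratic (hx i₀) (by exact_mod_cast ha i₀) (by exact_mod_cast h6) ?_
      rw [normSq_eq_norm_sq, h, sq_abs]
    have hF := congrArg norm (sub_eq_zero.1 ((hev _ _ _).symm.trans hx0))
    simp only [norm_prod, norm_mul, norm_pow, norm_intCast] at hF
    have hxi : ∀ i, ‖x i‖ ≠ 0 := by
      intro i h
      have h0 : x i = 0 := norm_eq_zero.1 h
      have := hx i
      rw [h0] at this
      simp [ha i] at this
    have hai : ∀ i, |(a i : ℝ)| ≠ 0 := fun i => abs_ne_zero.2 (by exact_mod_cast ha i)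
    rw [← mul_prod_erase univ _ (mem_univ i₀), ← mul_prod_erase univ _ (mem_univ i₀)] at hF
    have heq : ∏ i ∈ univ.erase i₀, |(a i : ℝ)| ^ (-m i).toNat * ‖x i‖ ^ (m i).toNat =
        ∏ i ∈ univ.erase i₀, |(a i : ℝ)| ^ (m i).toNat * ‖x i‖ ^ (-m i).toNat := by
      refine prod_congr rfl fun i hi => ?_
      by_cases hmi : m i = 0
      · simp [hmi]
      · rw [hj i (ne_of_mem_erase hi) hmi, mul_comm]
    rw [heq] at hF
    have hF := mul_right_cancel₀ (prod_ne_zero_iff.2 fun i _ =>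
      mul_ne_zero (pow_ne_zero _ (hai i)) (pow_ne_zero _ (hxi i))) hF
    rcases lt_or_gt_of_ne hi₀ with hlt | hlt
    · rw [Int.toNat_of_nonpos hlt.le, pow_zero, pow_zero, mul_one, one_mul] at hF
      exact hi ((pow_left_inj₀ (norm_nonneg _) (abs_nonneg _) (by omega)).1 hF.symm)
    · rw [Int.toNat_of_nonpos (by omega : -m i₀ ≤ 0), pow_zero, pow_zero, mul_one, one_mul] at hF
      exact hi ((pow_left_inj₀ (norm_nonneg _) (abs_nonneg _) (by omega)).1 hF)
  · refine h1 K (eval₂RingHom (Int.castRingHom K) c) (fun i => a i * y i) (fun i => ?_) ?_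
    · have hC : eval₂RingHom (Int.castRingHom K) c (C (a i ^ 2)) = (a i : K) ^ 2 := by
        rw [coe_eval₂RingHom, eval₂_C, eq_intCast, Int.cast_pow]
      have hX : eval₂RingHom (Int.castRingHom K) c X = c := by
        rw [coe_eval₂RingHom, eval₂_X]
      rw [hC, hX]
      linear_combination (a i : K) * hroot i
    · rw [hev]
      have hfac : ∀ i, (a i : K) ^ (-m i).toNat * ((a i : K) * y i) ^ (m i).toNat =
          y i ^ m i * ((a i : K) ^ (m i).toNat * ((a i : K) * y i) ^ (-m i).toNat) := by
        intro i
        rcases le_total 0 (m i) with h | h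
        · obtain ⟨n, hn⟩ := Int.eq_ofNat_of_zero_le h
          rw [Int.toNat_of_nonpos (by omega : -m i ≤ 0), hn]
          simp [mul_pow, mul_comm]
        · obtain ⟨n, hn⟩ := Int.eq_ofNat_of_zero_le (neg_nonneg.2 h)
          rw [Int.toNat_of_nonpos h, hn, show m i = -(n : ℤ) by omega]
          have := pow_ne_zero n (hy i)
          simp [mul_pow]
          field_simp
      rw [prod_congr rfl fun i _ => hfac i, prod_mul_distrib, hrel, one_mul, sub_self]

/-- For all but boundedly many `c` modulo `p`, the roots of the `a i (y + y⁻¹) + c` do not satisfy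
a given multiplicative relation. -/
theorem exists_exceptional_set {r : ℕ} (a : Fin r → ℤ) (ha : ∀ i, a i ≠ 0)
    (hdist : ∀ i j, i ≠ j → a i ≠ a j ∧ a i ≠ -a j) (m : Fin r → ℤ) (hm : m ≠ 0) :
    ∃ B P : ℕ, ∀ (p : ℕ) [Fact p.Prime], P ≤ p → (∀ i, (a i : ZMod p) ≠ 0) →
      ∃ E : Finset (ZMod p), #E ≤ B ∧ ∀ c ∉ E, ∀ y : Fin r → (ZMod p)ˣ,
        (∀ i, m i ≠ 0 → (a i : ZMod p) * (y i + (y i)⁻¹ : ZMod p) + c = 0) →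
        ∏ i, y i ^ m i ≠ 1 := by
  obtain ⟨N, hN, h⟩ := exists_polynomial_of_multiplicative_relation a ha hdist m hm
  refine ⟨N.natDegree, N.leadingCoeff.natAbs + 1, fun p _ hp hap => ?_⟩
  have hNp : N.map (Int.castRingHom (ZMod p)) ≠ 0 := by
    intro h0
    have h1 := congrArg (fun f => f.coeff N.natDegree) h0
    simp only [coeff_map, coeff_zero, coeff_natDegree, eq_intCast] at h1
    rw [ZMod.intCast_zmod_eq_zero_iff_dvd] at h1
    have := Int.eq_zero_of_abs_lt_dvd h1 (by rw [Int.abs_eq_natAbs]; omega)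
    exact hN (leadingCoeff_eq_zero.1 this)
  refine ⟨(N.map (Int.castRingHom (ZMod p))).roots.toFinset,
    (Multiset.toFinset_card_le _).trans ((card_roots' _).trans natDegree_map_le),
    fun c hc y hy hrel => hc ?_⟩
  rw [Multiset.mem_toFinset, mem_roots hNp, IsRoot, eval_map]
  let K := AlgebraicClosure (ZMod p)
  let φ : ZMod p →+* K := algebraMap (ZMod p) K
  have haK : ∀ i, (a i : K) ≠ 0 := fun i h0 => hap i (φ.injective (by simpa using h0))
  have hex : ∀ i, ∃ z : K, z ≠ 0 ∧ (a i : K) * (z ^ 2 + 1) + φ c * z = 0 ∧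
      z ^ m i = φ ((y i ^ m i : (ZMod p)ˣ) : ZMod p) := by
    intro i
    by_cases hmi : m i = 0
    · obtain ⟨z, hz⟩ := IsAlgClosed.exists_root
        (C (a i : K) * X ^ 2 + C (φ c) * X + C (a i : K) : K[X]) (by
          rw [degree_quadratic (haK i)]; norm_num)
      have hz : (a i : K) * z ^ 2 + φ c * z + a i = 0 := by simpa using hz
      refine ⟨z, ?_, by linear_combination hz, by simp [hmi]⟩
      rintro rfl
      simp [haK i] at hz
    · refine ⟨φ (y i), fun h0 => (y i).ne_zero (φ.injective (by rw [h0, map_zero])), ?_, ?_⟩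
      · have h1 : (a i : ZMod p) * ((y i : ZMod p) ^ 2 + 1) + c * y i = 0 := by
          have h2 := hy i hmi
          have h3 : (y i : ZMod p) * ((y i)⁻¹ : (ZMod p)ˣ) = 1 := Units.mul_inv _
          linear_combination (y i : ZMod p) * h2 - (a i : ZMod p) * h3
        simpa using congrArg φ h1
      · simp [Units.val_zpow_eq_zpow_val, map_zpow₀]
  choose z hz0 hz hzm using hex
  have h1 := h K (φ c) z haK hz0 hz (by
    rw [prod_congr rfl fun i _ => hzm i, ← map_prod, ← Units.coe_prod, hrel]; simp)
  refine φ.injective ?_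
  rw [hom_eval₂, map_zero, ← h1]
  congr 1

end Elimination

section PrimePowerModulus

variable {p n : ℕ}

/-- Reduction modulo `p`. -/
def primePowRed (p n : ℕ) : ZMod (p ^ (n + 1)) →+* ZMod p :=
  ZMod.castHom (dvd_pow_self p n.succ_ne_zero) (ZMod p)

theorem primePowRed_intCast (z : ℤ) : primePowRed p n z = z := map_intCast _ z

theorem primePowRed_surjective : Function.Surjective (primePowRed p n) :=
  ZMod.castHom_surjective _

/-- The reduction map on units. -/
def primePowUnitRed (p n : ℕ) : (ZMod (p ^ (n + 1)))ˣ →* (ZMod p)ˣ :=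
  Units.map (primePowRed p n : ZMod (p ^ (n + 1)) →* ZMod p)

theorem coe_primePowUnitRed (x : (ZMod (p ^ (n + 1)))ˣ) :
    (primePowUnitRed p n x : ZMod p) = primePowRed p n x := rfl

/-- Inflation of characters modulo `p`. -/
noncomputable def inflateChar (n : ℕ) (ψ : MulChar (ZMod p) ℂ) : MulChar (ZMod (p ^ (n + 1))) ℂ :=
  DirichletCharacter.changeLevel (dvd_pow_self p n.succ_ne_zero) ψ

theorem inflateChar_apply (ψ : MulChar (ZMod p) ℂ) (x : (ZMod (p ^ (n + 1)))ˣ) :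
    inflateChar n ψ x = ψ (primePowUnitRed p n x) :=
  DirichletCharacter.changeLevel_eq_cast_of_dvd _ _ _

variable [hp : Fact p.Prime]

/-- Multiplication by `p ^ n`, as a map from residues modulo `p` to residues modulo
`p ^ (n + 1)`. -/
def primePowEmb (p n : ℕ) : ZMod p →+ ZMod (p ^ (n + 1)) :=
  ZMod.lift p ⟨(AddMonoidHom.mulLeft ((p : ZMod (p ^ (n + 1))) ^ n)).comp
    (Int.castAddHom (ZMod (p ^ (n + 1)))), by
      have h := ZMod.natCast_self (p ^ (n + 1))
      rw [Nat.cast_pow] at h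
      simpa [← pow_succ] using h⟩

theorem primePowEmb_intCast (z : ℤ) :
    primePowEmb p n z = (p : ZMod (p ^ (n + 1))) ^ n * z := by
  simp [primePowEmb]

theorem primePowEmb_red (x : ZMod (p ^ (n + 1))) :
    primePowEmb p n (primePowRed p n x) = (p : ZMod (p ^ (n + 1))) ^ n * x := by
  obtain ⟨z, rfl⟩ := ZMod.intCast_surjective x
  rw [primePowRed_intCast, primePowEmb_intCast]

theorem mul_primePowEmb (x : ZMod (p ^ (n + 1))) (s : ZMod p) :
    x * primePowEmb p n s = primePowEmb p n (primePowRed p n x * s) := by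
  obtain ⟨t, rfl⟩ := primePowRed_surjective (n := n) s
  rw [← map_mul, primePowEmb_red, primePowEmb_red]
  ring

theorem primePowRed_emb (hn : n ≠ 0) (s : ZMod p) : primePowRed p n (primePowEmb p n s) = 0 := by
  obtain ⟨t, rfl⟩ := primePowRed_surjective (n := n) s
  rw [primePowEmb_red]
  simp [hn]

theorem primePowEmb_mul_emb (hn : n ≠ 0) (s t : ZMod p) :
    primePowEmb p n s * primePowEmb p n t = 0 := by
  rw [mul_primePowEmb, primePowRed_emb hn, zero_mul, map_zero]

theorem stdAddChar_primePowEmb (s : ZMod p) :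
    ZMod.stdAddChar (primePowEmb p n s) = ZMod.stdAddChar s := by
  obtain ⟨z, rfl⟩ := ZMod.intCast_surjective s
  have h := primePowEmb_intCast (p := p) (n := n) z
  rw [show (p : ZMod (p ^ (n + 1))) ^ n * (z : ZMod (p ^ (n + 1))) =
    (((p : ℤ) ^ n * z : ℤ) : ZMod (p ^ (n + 1))) by push_cast; rfl] at h
  rw [h, ZMod.stdAddChar_coe, ZMod.stdAddChar_coe]
  congr 1
  have : (p : ℂ) ≠ 0 := by exact_mod_cast hp.out.ne_zero
  push_cast
  field_simp
  ring

theorem primePowEmb_injective : Function.Injective (primePowEmb p n) := fun s t h =>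
  ZMod.injective_stdAddChar (by rw [← stdAddChar_primePowEmb (n := n), h, stdAddChar_primePowEmb])

theorem exists_primePowEmb_eq {x : ZMod (p ^ (n + 1))} (hx : x * p = 0) :
    ∃ s, primePowEmb p n s = x := by
  obtain ⟨z, rfl⟩ := ZMod.intCast_surjective x
  have h : (((z * p : ℤ)) : ZMod (p ^ (n + 1))) = 0 := by simpa using hx
  rw [ZMod.intCast_zmod_eq_zero_iff_dvd] at h
  push_cast at h
  rw [pow_succ] at h
  obtain ⟨t, rfl⟩ := Int.dvd_of_mul_dvd_mul_right (by exact_mod_cast hp.out.ne_zero) h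
  exact ⟨t, by rw [primePowEmb_intCast]; push_cast; rfl⟩

theorem isUnit_of_primePowRed_ne_zero {x : ZMod (p ^ (n + 1))} (hx : primePowRed p n x ≠ 0) :
    IsUnit x := by
  obtain ⟨m, rfl⟩ := ZMod.natCast_zmod_surjective x
  rw [map_natCast, Ne, ZMod.natCast_eq_zero_iff] at hx
  rw [ZMod.isUnit_iff_coprime]
  exact ((Nat.Prime.coprime_iff_not_dvd hp.out).2 hx).symm.pow_right _

/-- The unit `1 + p ^ n s`. -/
def primePowUnit (hn : n ≠ 0) (s : ZMod p) : (ZMod (p ^ (n + 1)))ˣ where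
  val := 1 + primePowEmb p n s
  inv := 1 - primePowEmb p n s
  val_inv := by linear_combination -primePowEmb_mul_emb hn s s
  inv_val := by linear_combination -primePowEmb_mul_emb hn s s

theorem coe_primePowUnit (hn : n ≠ 0) (s : ZMod p) :
    (primePowUnit hn s : ZMod (p ^ (n + 1))) = 1 + primePowEmb p n s := rfl

theorem coe_primePowUnit_inv (hn : n ≠ 0) (s : ZMod p) :
    ((primePowUnit hn s)⁻¹ : (ZMod (p ^ (n + 1)))ˣ) = 1 - primePowEmb p n s := rfl

theorem primePowUnit_add (hn : n ≠ 0) (s t : ZMod p) :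
    primePowUnit hn (s + t) = primePowUnit hn s * primePowUnit hn t := by
  ext
  simp only [Units.val_mul, coe_primePowUnit, map_add]
  linear_combination -primePowEmb_mul_emb hn s t

theorem primePowUnit_zero (hn : n ≠ 0) : primePowUnit hn (0 : ZMod p) = 1 := by
  ext
  simp [coe_primePowUnit]

theorem primePowUnitRed_unit (hn : n ≠ 0) (s : ZMod p) :
    primePowUnitRed p n (primePowUnit hn s) = 1 := by
  ext
  simp [coe_primePowUnitRed, coe_primePowUnit, primePowRed_emb hn]

theorem primePowUnit_injective (hn : n ≠ 0) : Function.Injective (primePowUnit (p := p) hn) :=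
  fun s t h => primePowEmb_injective (n := n) (by
    simpa [coe_primePowUnit] using congrArg Units.val h)

/-- The additive character `s ↦ χ(1 + p ^ n s)`. -/
noncomputable def localAddChar (hn : n ≠ 0) (χ : MulChar (ZMod (p ^ (n + 1))) ℂ) :
    AddChar (ZMod p) ℂ where
  toFun s := χ (primePowUnit hn s)
  map_zero_eq_one' := by rw [primePowUnit_zero]; simp
  map_add_eq_mul' s t := by rw [primePowUnit_add]; simp

theorem exists_mulShift_eq (ψ : AddChar (ZMod p) ℂ) :
    ∃ c : ZMod p, ∀ s, ψ s = ZMod.stdAddChar (c * s) := by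
  have h : Function.Bijective (fun c : ZMod p => (ZMod.stdAddChar (N := p)).mulShift c) :=
    (Nat.bijective_iff_injective_and_card _).2
      ⟨AddChar.to_mulShift_inj_of_isPrimitive (ZMod.isPrimitive_stdAddChar p), by
        rw [Nat.card_eq_fintype_card, Nat.card_eq_fintype_card, AddChar.card_eq]⟩
  obtain ⟨c, hc⟩ := h.2 ψ
  exact ⟨c, fun s => by rw [← hc]; rfl⟩

/-- The residue `c` with `χ(1 + p ^ n s) = e_p(c s)`. -/
noncomputable def localFreq (hn : n ≠ 0) (χ : MulChar (ZMod (p ^ (n + 1))) ℂ) : ZMod p :=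
  (exists_mulShift_eq (localAddChar hn χ)).choose

theorem apply_primePowUnit (hn : n ≠ 0) (χ : MulChar (ZMod (p ^ (n + 1))) ℂ) (s : ZMod p) :
    χ (primePowUnit hn s) = ZMod.stdAddChar (localFreq hn χ * s) :=
  (exists_mulShift_eq (localAddChar hn χ)).choose_spec s

theorem sum_stdAddChar_mul (b : ZMod p) :
    ∑ s : ZMod p, ZMod.stdAddChar (b * s) = if b = 0 then (p : ℂ) else 0 := by
  have := AddChar.sum_mulShift b (ZMod.isPrimitive_stdAddChar p)
  simp only [mul_comm _ b] at this
  rw [this]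
  split_ifs <;> simp [ZMod.card]

theorem localFreq_eq_of_forall (hn : n ≠ 0) {χ : MulChar (ZMod (p ^ (n + 1))) ℂ} {c : ZMod p}
    (h : ∀ s, χ (primePowUnit hn s) = ZMod.stdAddChar (c * s)) : localFreq hn χ = c := by
  refine AddChar.to_mulShift_inj_of_isPrimitive (ZMod.isPrimitive_stdAddChar p) ?_
  ext s
  rw [AddChar.mulShift_apply, AddChar.mulShift_apply, ← h, apply_primePowUnit]

theorem card_localFreq_eq (hn : n ≠ 0) (c : ZMod p) :
    #{χ : MulChar (ZMod (p ^ (n + 1))) ℂ | localFreq hn χ = c} = p ^ (n - 1) * (p - 1) := by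
  classical
  have hp0 : (p : ℂ) ≠ 0 := by exact_mod_cast hp.out.ne_zero
  have h1 : ∀ χ : MulChar (ZMod (p ^ (n + 1))) ℂ,
      ∑ s, χ (primePowUnit hn s) * ZMod.stdAddChar (-c * s) =
        p * if localFreq hn χ = c then 1 else 0 := by
    intro χ
    simp only [apply_primePowUnit, ← AddChar.map_add_eq_mul, ← add_mul]
    rw [sum_stdAddChar_mul, ← sub_eq_add_neg]
    simp [sub_eq_zero]
  have h2 : ∑ χ : MulChar (ZMod (p ^ (n + 1))) ℂ,
      ∑ s, χ (primePowUnit hn s) * ZMod.stdAddChar (-c * s) = (p ^ (n + 1)).totient := by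
    rw [sum_comm]
    simp only [← sum_mul]
    rw [sum_eq_single 0]
    · rw [DirichletCharacter.sum_characters_eq]
      simp [primePowUnit_zero]
    · intro s _ hs
      rw [DirichletCharacter.sum_characters_eq, if_neg, zero_mul]
      intro h
      exact hs (primePowUnit_injective hn (Units.ext (by rw [h, primePowUnit_zero]; rfl)))
    · simp
  simp only [h1, ← mul_sum, sum_boole] at h2
  rw [Nat.totient_prime_pow_succ hp.out] at h2
  obtain ⟨m, rfl⟩ := Nat.exists_eq_succ_of_ne_zero hn
  have h3 : p * #{χ : MulChar (ZMod (p ^ (m + 1 + 1))) ℂ | localFreq hn χ = c} =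
      p * (p ^ m * (p - 1)) := by
    rw [← mul_assoc, ← pow_succ']
    exact_mod_cast h2
  exact Nat.eq_of_mul_eq_mul_left hp.out.pos h3

theorem localFreq_mul_inflateChar (hn : n ≠ 0) (χ : MulChar (ZMod (p ^ (n + 1))) ℂ)
    (ψ : MulChar (ZMod p) ℂ) : localFreq hn (χ * inflateChar n ψ) = localFreq hn χ :=
  localFreq_eq_of_forall hn fun s => by
    rw [MulChar.mul_apply, inflateChar_apply, primePowUnitRed_unit, apply_primePowUnit]
    simp

end PrimePowerModulus

section FiberSums

variable {p n : ℕ} [hp : Fact p.Prime]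

/-- The terms of the twisted Kloosterman sum. -/
noncomputable def kloosTerm (a : ZMod (p ^ (n + 1))) (χ : MulChar (ZMod (p ^ (n + 1))) ℂ)
    (x : (ZMod (p ^ (n + 1)))ˣ) : ℂ :=
  ZMod.stdAddChar (N := p ^ (n + 1))
      (a * ((x : ZMod (p ^ (n + 1))) - (x⁻¹ : (ZMod (p ^ (n + 1)))ˣ))) * χ x

/-- The part of the twisted Kloosterman sum over a residue class modulo `p`. -/
noncomputable def kloosFiber (a : ZMod (p ^ (n + 1))) (χ : MulChar (ZMod (p ^ (n + 1))) ℂ)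
    (y : (ZMod p)ˣ) : ℂ :=
  ∑ x with primePowUnitRed p n x = y, kloosTerm a χ x

theorem sum_kloosFiber (a : ZMod (p ^ (n + 1))) (χ : MulChar (ZMod (p ^ (n + 1))) ℂ) :
    ∑ y, kloosFiber a χ y = ∑ x, kloosTerm a χ x :=
  sum_fiberwise _ _ _

theorem kloosTerm_mul_primePowUnit (hn : n ≠ 0) (a : ZMod (p ^ (n + 1)))
    (χ : MulChar (ZMod (p ^ (n + 1))) ℂ) (x : (ZMod (p ^ (n + 1)))ˣ) (s : ZMod p) :
    kloosTerm a χ (x * primePowUnit hn s) = ZMod.stdAddChar (N := p) ((primePowRed p n a *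
      (primePowUnitRed p n x + ((primePowUnitRed p n x)⁻¹ : (ZMod p)ˣ)) +
        localFreq hn χ) * s) * kloosTerm a χ x := by
  have h : a * ((x * primePowUnit hn s : (ZMod (p ^ (n + 1)))ˣ) -
      ((x * primePowUnit hn s)⁻¹ : (ZMod (p ^ (n + 1)))ˣ) : ZMod (p ^ (n + 1))) =
      a * ((x : ZMod (p ^ (n + 1))) - (x⁻¹ : (ZMod (p ^ (n + 1)))ˣ)) +
      primePowEmb p n (primePowRed p n a *
        (primePowUnitRed p n x + ((primePowUnitRed p n x)⁻¹ : (ZMod p)ˣ)) * s) := by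
    rw [← map_inv, coe_primePowUnitRed, coe_primePowUnitRed, ← map_add, ← map_mul,
      ← mul_primePowEmb, mul_inv_rev, Units.val_mul, Units.val_mul, coe_primePowUnit_inv,
      coe_primePowUnit]
    ring
  rw [kloosTerm, kloosTerm, h, AddChar.map_add_eq_mul, stdAddChar_primePowEmb, Units.val_mul,
    map_mul χ, apply_primePowUnit, add_mul, AddChar.map_add_eq_mul]
  ring

theorem kloosFiber_eq_zero (hn : n ≠ 0) {a : ZMod (p ^ (n + 1))}
    {χ : MulChar (ZMod (p ^ (n + 1))) ℂ} {y : (ZMod p)ˣ}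
    (h : primePowRed p n a * (y + (y⁻¹ : (ZMod p)ˣ)) + localFreq hn χ ≠ 0) :
    kloosFiber a χ y = 0 := by
  have h1 : kloosFiber a χ y =
      ZMod.stdAddChar (N := p) (primePowRed p n a * (y + (y⁻¹ : (ZMod p)ˣ)) +
      localFreq hn χ) * kloosFiber a χ y := by
    conv_lhs => rw [kloosFiber]
    rw [kloosFiber, mul_sum]
    refine (sum_bij (fun x _ => x * primePowUnit hn 1) ?_ ?_ ?_ ?_).symm
    · intro x hx
      simpa [primePowUnitRed_unit] using hx
    · intro x _ x' _ h
      exact mul_right_cancel h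
    · intro x hx
      exact ⟨x * (primePowUnit hn 1)⁻¹, by simpa [primePowUnitRed_unit] using hx, by simp⟩
    · intro x hx
      rw [kloosTerm_mul_primePowUnit, mul_one, (mem_filter.1 hx).2]
  by_contra h0
  have h2 := mul_right_cancel₀ h0 ((one_mul _).trans h1)
  exact h (ZMod.injective_stdAddChar (by rw [← h2, AddChar.map_zero_eq_one]))

theorem kloosTerm_inv (a : ZMod (p ^ (n + 1))) (χ : MulChar (ZMod (p ^ (n + 1))) ℂ)
    (x : (ZMod (p ^ (n + 1)))ˣ) :
    kloosTerm a χ x⁻¹ = (starRingEnd ℂ) (kloosTerm a χ x) := by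
  rw [kloosTerm, kloosTerm, map_mul (starRingEnd ℂ), ← AddChar.map_neg_eq_conj, inv_inv]
  congr 1
  · congr 1
    ring
  · have := MulChar.star_apply' χ (x : ZMod (p ^ (n + 1)))
    rw [starRingEnd_apply, this, MulChar.inv_apply]
    simp

theorem kloosFiber_inv (a : ZMod (p ^ (n + 1))) (χ : MulChar (ZMod (p ^ (n + 1))) ℂ)
    (y : (ZMod p)ˣ) : kloosFiber a χ y⁻¹ = (starRingEnd ℂ) (kloosFiber a χ y) := by
  rw [kloosFiber, kloosFiber, map_sum]
  refine (sum_bij (fun x _ => x⁻¹) ?_ ?_ ?_ ?_).symm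
  · intro x hx
    simpa using hx
  · intro x _ x' _ h
    exact inv_injective h
  · intro x hx
    exact ⟨x⁻¹, by simpa [inv_eq_iff_eq_inv] using hx, inv_inv x⟩
  · intro x hx
    rw [kloosTerm_inv]

theorem kloosFiber_mul_inflateChar (a : ZMod (p ^ (n + 1))) (χ : MulChar (ZMod (p ^ (n + 1))) ℂ)
    (ψ : MulChar (ZMod p) ℂ) (y : (ZMod p)ˣ) :
    kloosFiber a (χ * inflateChar n ψ) y = ψ y * kloosFiber a χ y := by
  rw [kloosFiber, kloosFiber, mul_sum]
  refine sum_congr rfl fun x hx => ?_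
  rw [kloosTerm, kloosTerm, MulChar.mul_apply, inflateChar_apply, (mem_filter.1 hx).2]
  ring

theorem card_primePowRed_fiber (y : ZMod p) :
    #{x : ZMod (p ^ (n + 1)) | primePowRed p n x = y} = p ^ n := by
  have h : ∀ y, #{x : ZMod (p ^ (n + 1)) | primePowRed p n x = y} =
      #{x : ZMod (p ^ (n + 1)) | primePowRed p n x = 0} := by
    intro y
    obtain ⟨t, rfl⟩ := primePowRed_surjective (n := n) y
    refine card_bij (fun x _ => x - t) ?_ ?_ ?_
    · intro x hx
      simpa [sub_eq_zero] using hx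
    · intro x _ x' _ h
      exact sub_left_injective h
    · intro x hx
      exact ⟨x + t, by simpa using hx, by simp⟩
  have h1 := card_eq_sum_card_fiberwise (f := primePowRed p n) (s := univ) (t := univ)
    (fun _ _ => by simp)
  simp only [h] at h1
  rw [card_univ, ZMod.card, sum_const, card_univ, ZMod.card, smul_eq_mul] at h1
  rw [h, Nat.eq_of_mul_eq_mul_left hp.out.pos (h1.symm.trans (pow_succ' p n))]

theorem card_primePowUnitRed_fiber (y : (ZMod p)ˣ) :
    #{x : (ZMod (p ^ (n + 1)))ˣ | primePowUnitRed p n x = y} = p ^ n := by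
  rw [← card_primePowRed_fiber (n := n) (y : ZMod p)]
  refine card_bij (fun x _ => (x : ZMod (p ^ (n + 1)))) ?_ ?_ ?_
  · intro x hx
    simp only [mem_filter_univ] at hx ⊢
    rw [← hx, coe_primePowUnitRed]
  · intro x _ x' _ h
    exact Units.ext h
  · intro x hx
    simp only [mem_filter_univ] at hx
    obtain ⟨u, rfl⟩ := isUnit_of_primePowRed_ne_zero (x := x) (by rw [hx]; exact y.ne_zero)
    exact ⟨u, by simpa using Units.ext hx, rfl⟩

theorem sum_primePowRed_fiber_eq_zero {b : ZMod (p ^ (n + 1))} (hb : b * p ≠ 0)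
    (t : ZMod p) :
    ∑ w : ZMod (p ^ (n + 1)) with primePowRed p n w = t,
        ZMod.stdAddChar (N := p ^ (n + 1)) (b * w) = 0 := by
  have h1 : ∑ w : ZMod (p ^ (n + 1)) with primePowRed p n w = t,
      ZMod.stdAddChar (N := p ^ (n + 1)) (b * w) =
      ZMod.stdAddChar (N := p ^ (n + 1)) (b * p) *
        ∑ w : ZMod (p ^ (n + 1)) with primePowRed p n w = t,
            ZMod.stdAddChar (N := p ^ (n + 1)) (b * w) := by
    rw [mul_sum]
    refine (sum_bij (fun (x : ZMod (p ^ (n + 1))) _ => x + (p : ZMod (p ^ (n + 1))))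
        ?_ ?_ ?_ ?_).symm
    · intro x hx
      simpa using hx
    · intro x _ x' _ h
      exact add_left_injective _ h
    · intro x hx
      exact ⟨x - p, by simpa using hx, by simp⟩
    · intro x hx
      rw [mul_add, AddChar.map_add_eq_mul, mul_comm]
  by_contra h0
  have h2 := mul_right_cancel₀ h0 ((one_mul _).trans h1)
  exact hb (ZMod.injective_stdAddChar (by rw [← h2, AddChar.map_zero_eq_one]))

theorem sum_primePowRed_fiber_emb (s t : ZMod p) :
    ∑ w : ZMod (p ^ (n + 1)) with primePowRed p n w = t,
      ZMod.stdAddChar (primePowEmb p n s * w) = p ^ n * ZMod.stdAddChar (s * t) := by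
  rw [sum_congr rfl (g := fun _ => (ZMod.stdAddChar (s * t) : ℂ)), sum_const,
    card_primePowRed_fiber]
  · simp
  · intro w hw
    rw [mul_comm, mul_primePowEmb, stdAddChar_primePowEmb, (mem_filter.1 hw).2, mul_comm]

theorem sum_primePowUnitRed_fiber {y : (ZMod p)ˣ} (hy : y ^ 2 ≠ 1) {v : (ZMod (p ^ (n + 1)))ˣ}
    (hv : primePowUnitRed p n v = 1) (f : ZMod (p ^ (n + 1)) → ℂ) :
    ∑ x with primePowUnitRed p n x = y, f (x + (x⁻¹ * v : (ZMod (p ^ (n + 1)))ˣ)) =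
      ∑ w : ZMod (p ^ (n + 1)) with primePowRed p n w = y + (y⁻¹ : (ZMod p)ˣ), f w := by
  have hmem : ∀ x ∈ ({x | primePowUnitRed p n x = y} : Finset (ZMod (p ^ (n + 1)))ˣ),
      (x + (x⁻¹ * v : (ZMod (p ^ (n + 1)))ˣ) : ZMod (p ^ (n + 1))) ∈
        ({w | primePowRed p n w = y + (y⁻¹ : (ZMod p)ˣ)} : Finset (ZMod (p ^ (n + 1)))) := by
    intro x hx
    simp only [mem_filter_univ] at hx ⊢
    rw [map_add, ← coe_primePowUnitRed, ← coe_primePowUnitRed, map_mul, map_inv, hx, hv, mul_one]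
  have hinj : ∀ x ∈ ({x | primePowUnitRed p n x = y} : Finset (ZMod (p ^ (n + 1)))ˣ),
      ∀ x' ∈ ({x | primePowUnitRed p n x = y} : Finset (ZMod (p ^ (n + 1)))ˣ),
      (x + (x⁻¹ * v : (ZMod (p ^ (n + 1)))ˣ) : ZMod (p ^ (n + 1))) =
        x' + (x'⁻¹ * v : (ZMod (p ^ (n + 1)))ˣ) → x = x' := by
    intro x hx x' hx' h
    simp only [mem_filter_univ] at hx hx'
    have hu : IsUnit (1 - (v * (x⁻¹ * x'⁻¹) : (ZMod (p ^ (n + 1)))ˣ) : ZMod (p ^ (n + 1))) := by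
      refine isUnit_of_primePowRed_ne_zero fun h0 => hy ?_
      rw [map_sub, map_one, ← coe_primePowUnitRed, map_mul, map_mul, map_inv, map_inv, hx, hx', hv,
        one_mul, sub_eq_zero, ← Units.val_one, Units.val_inj] at h0
      rw [sq, ← inv_eq_one, mul_inv, ← h0]
    have h1 : (x : ZMod (p ^ (n + 1))) * (x⁻¹ : (ZMod (p ^ (n + 1)))ˣ) = 1 := Units.mul_inv _
    have h2 : (x' : ZMod (p ^ (n + 1))) * (x'⁻¹ : (ZMod (p ^ (n + 1)))ˣ) = 1 := Units.mul_inv _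
    have h3 : ((x : ZMod (p ^ (n + 1))) - x') *
        (1 - (v * (x⁻¹ * x'⁻¹) : (ZMod (p ^ (n + 1)))ˣ) : ZMod (p ^ (n + 1))) = 0 := by
      simp only [Units.val_mul] at h ⊢
      linear_combination h - v * (x'⁻¹ : (ZMod (p ^ (n + 1)))ˣ) * h1 +
        v * (x⁻¹ : (ZMod (p ^ (n + 1)))ˣ) * h2
    exact Units.ext (sub_eq_zero.1 (hu.mul_left_eq_zero.1 h3))
  refine sum_bij (fun x _ => (x + (x⁻¹ * v : (ZMod (p ^ (n + 1)))ˣ) : ZMod (p ^ (n + 1)))) hmem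
    (fun x hx x' hx' => hinj x hx x' hx') ?_ fun _ _ => rfl
  intro w hw
  obtain ⟨x, hx, h⟩ := surj_on_of_inj_on_of_card_le
    (fun (x : (ZMod (p ^ (n + 1)))ˣ) _ => (x + (x⁻¹ * v : (ZMod (p ^ (n + 1)))ˣ) :
      ZMod (p ^ (n + 1)))) hmem (fun x x' hx hx' => hinj x hx x' hx')
    (by rw [card_primePowRed_fiber, card_primePowUnitRed_fiber]) w hw
  exact ⟨x, hx, h.symm⟩

theorem kloosTerm_mul_conj (a : ZMod (p ^ (n + 1))) (χ : MulChar (ZMod (p ^ (n + 1))) ℂ)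
    (x v : (ZMod (p ^ (n + 1)))ˣ) :
    kloosTerm a χ (x * v) * (starRingEnd ℂ) (kloosTerm a χ x) =
      χ v * ZMod.stdAddChar (N := p ^ (n + 1))
          (a * (v - 1) * (x + (x⁻¹ * v⁻¹ : (ZMod (p ^ (n + 1)))ˣ))) := by
  have h1 : χ (x : ZMod (p ^ (n + 1))) * χ ((x⁻¹ : (ZMod (p ^ (n + 1)))ˣ) : ZMod (p ^ (n + 1))) =
      1 := by
    rw [← map_mul, Units.mul_inv, map_one]
  have h2 : (v : ZMod (p ^ (n + 1))) * (v⁻¹ : (ZMod (p ^ (n + 1)))ˣ) = 1 := Units.mul_inv _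
  rw [← kloosTerm_inv, kloosTerm, kloosTerm, inv_inv, mul_inv, Units.val_mul, map_mul χ,
    mul_mul_mul_comm, ← AddChar.map_add_eq_mul, mul_right_comm (χ x), h1, one_mul, mul_comm,
    Units.val_mul]
  congr 2
  linear_combination -a * (x⁻¹ : (ZMod (p ^ (n + 1)))ˣ) * h2

theorem normSq_kloosFiber (hn : n ≠ 0) {a : ZMod (p ^ (n + 1))} (ha : primePowRed p n a ≠ 0)
    {χ : MulChar (ZMod (p ^ (n + 1))) ℂ} {y : (ZMod p)ˣ} (hy : y ^ 2 ≠ 1)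
    (h : primePowRed p n a * (y + (y⁻¹ : (ZMod p)ˣ)) + localFreq hn χ = 0) :
    normSq (kloosFiber a χ y) = p ^ (n + 1) := by
  classical
  have hau := isUnit_of_primePowRed_ne_zero ha
  have h1 : (normSq (kloosFiber a χ y) : ℂ) =
      ∑ v with primePowUnitRed p n v = 1, χ v *
        ∑ w : ZMod (p ^ (n + 1)) with primePowRed p n w = y + (y⁻¹ : (ZMod p)ˣ),
          ZMod.stdAddChar (N := p ^ (n + 1)) (a * (v - 1) * w) := by
    rw [← mul_conj, mul_comm, kloosFiber, map_sum, sum_mul]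
    have h2 : ∀ x ∈ ({x | primePowUnitRed p n x = y} : Finset (ZMod (p ^ (n + 1)))ˣ),
        (starRingEnd ℂ) (kloosTerm a χ x) *
          ∑ x with primePowUnitRed p n x = y, kloosTerm a χ x =
        ∑ v with primePowUnitRed p n v = 1, χ v *
          ZMod.stdAddChar (N := p ^ (n + 1))
              (a * (v - 1) * (x + (x⁻¹ * v⁻¹ : (ZMod (p ^ (n + 1)))ˣ))) := by
      intro x hx
      simp only [mem_filter_univ] at hx
      rw [mul_sum]
      refine (sum_bij (fun v _ => x * v) ?_ ?_ ?_ ?_).symm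
      · intro v hv
        simp only [mem_filter_univ] at hv ⊢
        rw [map_mul, hx, hv, mul_one]
      · intro v _ v' _ h
        exact mul_left_cancel h
      · intro z hz
        simp only [mem_filter_univ] at hz
        exact ⟨x⁻¹ * z, by simp [hx, hz], by simp⟩
      · intro v _
        rw [← kloosTerm_mul_conj, mul_comm]
    rw [sum_congr rfl h2, sum_comm]
    refine sum_congr rfl fun v hv => ?_
    rw [← mul_sum]
    congr 1
    exact sum_primePowUnitRed_fiber hy (v := v⁻¹) (by simpa using hv)
      fun w => ZMod.stdAddChar (N := p ^ (n + 1)) (a * (v - 1) * w)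
  have h2 : ∑ v with primePowUnitRed p n v = 1, χ v *
        ∑ w : ZMod (p ^ (n + 1)) with primePowRed p n w = y + (y⁻¹ : (ZMod p)ˣ),
          ZMod.stdAddChar (N := p ^ (n + 1)) (a * (v - 1) * w) =
      ∑ s : ZMod p, (p : ℂ) ^ n * ZMod.stdAddChar (0 * s) := by
    symm
    refine sum_of_injOn (primePowUnit hn) (primePowUnit_injective hn).injOn ?_ ?_ ?_
    · intro s _
      simp [primePowUnitRed_unit]
    · intro v _ hv
      rw [sum_primePowRed_fiber_eq_zero, mul_zero]
      intro h0
      rw [mul_assoc, hau.mul_right_eq_zero] at h0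
      obtain ⟨s, hs⟩ := exists_primePowEmb_eq h0
      exact hv ⟨s, by simp, Units.ext (by rw [coe_primePowUnit, hs]; ring)⟩
    · intro s _
      rw [coe_primePowUnit, add_sub_cancel_left, mul_primePowEmb, sum_primePowRed_fiber_emb,
        ← coe_primePowUnit hn, apply_primePowUnit, ← h, add_mul, AddChar.map_add_eq_mul]
      ring_nf
  rw [h2, ← mul_sum, sum_stdAddChar_mul, if_pos rfl, ← pow_succ] at h1
  exact_mod_cast h1

end FiberSums

section NormalizedSums

variable {p n : ℕ} [hp : Fact p.Prime]

theorem eZMod_eq_stdAddChar {q : ℕ} [NeZero q] (x : ZMod q) : eZMod q x = ZMod.stdAddChar x := by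
  rw [eZMod, ZMod.stdAddChar_apply, ZMod.toCircle_apply]

theorem Kloos_eq_sum_kloosTerm (a : ZMod (p ^ (n + 1))) (χ : MulChar (ZMod (p ^ (n + 1))) ℂ) :
    Kloos (p ^ (n + 1)) a (-a) χ = ∑ x, kloosTerm a χ x := by
  rw [Kloos]
  refine (sum_bij (fun (x : (ZMod (p ^ (n + 1)))ˣ) _ => (x : ZMod (p ^ (n + 1))).val)
    ?_ ?_ ?_ ?_).symm
  · intro x _
    rw [mem_filter, mem_range]
    exact ⟨ZMod.val_lt _, ZMod.val_coe_unit_coprime x⟩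
  · intro x _ x' _ h
    exact Units.ext (ZMod.val_injective _ h)
  · intro m hm
    rw [mem_filter, mem_range] at hm
    refine ⟨ZMod.unitOfCoprime m hm.2, mem_univ _, ?_⟩
    rw [ZMod.coe_unitOfCoprime, ZMod.val_cast_of_lt hm.1]
  · intro x _
    rw [ZMod.natCast_zmod_val, ZMod.inv_coe_unit, eZMod_eq_stdAddChar, kloosTerm]
    congr 2
    ring

theorem nKloos_eq_re_div (a : ℤ) (χ : MulChar (ZMod (p ^ (n + 1))) ℂ) :
    nKloos (p ^ (n + 1)) a χ = (∑ y, kloosFiber (a : ZMod (p ^ (n + 1))) χ y).re /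
      √(p ^ (n + 1)) := by
  rw [nKloos, Kloos_eq_sum_kloosTerm, sum_kloosFiber, Complex.smul_re, smul_eq_mul,
    Real.rpow_neg (by positivity), ← Real.sqrt_eq_rpow, mul_comm, div_eq_mul_inv]
  push_cast
  rfl

theorem eq_or_eq_inv_of_root {A c : ZMod p} (hA : A ≠ 0) {y y' : (ZMod p)ˣ}
    (h : A * (y + (y⁻¹ : (ZMod p)ˣ)) + c = 0) (h' : A * (y' + (y'⁻¹ : (ZMod p)ˣ)) + c = 0) :
    y' = y ∨ y' = y⁻¹ := by
  have h1 : (y : ZMod p) * (y⁻¹ : (ZMod p)ˣ) = 1 := Units.mul_inv _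
  have h2 : (y' : ZMod p) * (y'⁻¹ : (ZMod p)ˣ) = 1 := Units.mul_inv _
  have h3 : A * (((y' : ZMod p) - y) * (y' - (y⁻¹ : (ZMod p)ˣ))) = 0 := by
    linear_combination (y' : ZMod p) * (h' - h) - A * h2 + A * h1
  rcases mul_eq_zero.1 ((mul_eq_zero.1 h3).resolve_left hA) with h4 | h4
  · exact Or.inl (Units.ext (sub_eq_zero.1 h4))
  · exact Or.inr (Units.ext (sub_eq_zero.1 h4))

theorem sq_ne_one_of_root {A c : ZMod p} (hc : c ^ 2 - 4 * A ^ 2 ≠ 0) {y : (ZMod p)ˣ}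
    (h : A * (y + (y⁻¹ : (ZMod p)ˣ)) + c = 0) : y ^ 2 ≠ 1 := by
  intro h1
  have h2 : y⁻¹ = y := by rw [inv_eq_iff_mul_eq_one, ← sq, h1]
  have h3 : (y : ZMod p) ^ 2 = 1 := by simpa using congrArg Units.val h1
  rw [h2] at h
  exact hc (by linear_combination (c - 2 * A * y) * h + 4 * A ^ 2 * h3)

theorem exists_root_of_quadraticChar_eq_one {A c : ZMod p} (hp2 : p ≠ 2) (hA : A ≠ 0)
    (h : quadraticChar (ZMod p) (c ^ 2 - 4 * A ^ 2) = 1) :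
    ∃ y : (ZMod p)ˣ, A * (y + (y⁻¹ : (ZMod p)ˣ)) + c = 0 := by
  have h2 : (2 : ZMod p) ≠ 0 := Ring.two_ne_zero (by rwa [ZMod.ringChar_zmod_n])
  have hne : c ^ 2 - 4 * A ^ 2 ≠ 0 := fun h0 => by
    rw [h0, quadraticChar_zero] at h
    exact zero_ne_one h
  obtain ⟨t, ht⟩ := (quadraticChar_one_iff_isSquare hne).1 h
  have h3 : (-c + t) * (-c - t) = 4 * A ^ 2 := by linear_combination ht
  have h4 : (4 : ZMod p) ≠ 0 := by
    have := mul_ne_zero h2 h2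
    norm_num at this
    exact this
  have h5 : -c + t ≠ 0 := fun h0 => by
    rw [h0, zero_mul] at h3
    exact mul_ne_zero h4 (pow_ne_zero 2 hA) h3.symm
  have h6 : (-c + t) / (2 * A) ≠ 0 := div_ne_zero h5 (mul_ne_zero h2 hA)
  refine ⟨Units.mk0 _ h6, ?_⟩
  rw [Units.val_inv_eq_inv_val, Units.val_mk0, inv_div]
  field_simp
  linear_combination -ht

theorem isSquare_of_root {A c : ZMod p} {y : (ZMod p)ˣ}
    (h : A * (y + (y⁻¹ : (ZMod p)ˣ)) + c = 0) : IsSquare (c ^ 2 - 4 * A ^ 2) := by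
  refine ⟨A * (y - (y⁻¹ : (ZMod p)ˣ)), ?_⟩
  have h1 : (y : ZMod p) * (y⁻¹ : (ZMod p)ˣ) = 1 := Units.mul_inv _
  linear_combination (c - A * (y + (y⁻¹ : (ZMod p)ˣ))) * h + 4 * A ^ 2 * h1

theorem nKloos_eq_zero (hn : n ≠ 0) {a : ℤ} {χ : MulChar (ZMod (p ^ (n + 1))) ℂ}
    (hc : localFreq hn χ ^ 2 - 4 * (a : ZMod p) ^ 2 ≠ 0)
    (h : quadraticChar (ZMod p) (localFreq hn χ ^ 2 - 4 * (a : ZMod p) ^ 2) ≠ 1) :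
    nKloos (p ^ (n + 1)) a χ = 0 := by
  rw [nKloos_eq_re_div, sum_eq_zero, zero_re, zero_div]
  intro y _
  refine kloosFiber_eq_zero hn fun h0 => h ?_
  rw [primePowRed_intCast] at h0
  exact (quadraticChar_one_iff_isSquare hc).2 (isSquare_of_root h0)

theorem nKloos_eq_of_root (hn : n ≠ 0) {a : ℤ} (ha : (a : ZMod p) ≠ 0)
    {χ : MulChar (ZMod (p ^ (n + 1))) ℂ} {y : (ZMod p)ˣ}
    (hc : localFreq hn χ ^ 2 - 4 * (a : ZMod p) ^ 2 ≠ 0)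
    (h : (a : ZMod p) * (y + (y⁻¹ : (ZMod p)ˣ)) + localFreq hn χ = 0) :
    nKloos (p ^ (n + 1)) a χ =
      2 * (kloosFiber (a : ZMod (p ^ (n + 1))) χ y / √(p ^ (n + 1))).re := by
  have hy := sq_ne_one_of_root hc h
  rw [nKloos_eq_re_div, Fintype.sum_eq_add y y⁻¹, kloosFiber_inv, add_conj, ofReal_re,
    Complex.div_ofReal_re]
  · ring
  · intro h0
    rw [eq_inv_iff_mul_eq_one, ← sq] at h0
    exact hy h0
  · intro z hz
    refine kloosFiber_eq_zero hn fun h0 => ?_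
    rw [primePowRed_intCast] at h0
    rcases eq_or_eq_inv_of_root ha h h0 with h1 | h1
    · exact hz.1 h1
    · exact hz.2 h1

theorem norm_kloosFiber_div (hn : n ≠ 0) {a : ℤ} (ha : (a : ZMod p) ≠ 0)
    {χ : MulChar (ZMod (p ^ (n + 1))) ℂ} {y : (ZMod p)ˣ}
    (hc : localFreq hn χ ^ 2 - 4 * (a : ZMod p) ^ 2 ≠ 0)
    (h : (a : ZMod p) * (y + (y⁻¹ : (ZMod p)ˣ)) + localFreq hn χ = 0) :
    ‖kloosFiber (a : ZMod (p ^ (n + 1))) χ y / √(p ^ (n + 1))‖ = 1 := by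
  have h1 := normSq_kloosFiber hn (a := (a : ZMod (p ^ (n + 1)))) (χ := χ) (y := y)
    (by rwa [primePowRed_intCast]) (sq_ne_one_of_root hc h) (by rwa [primePowRed_intCast])
  have hp0 : (0 : ℝ) < p ^ (n + 1) := by
    have : (0 : ℝ) < p := by exact_mod_cast hp.out.pos
    positivity
  rw [normSq_eq_norm_sq] at h1
  rw [norm_div, norm_real, Real.norm_eq_abs, abs_of_nonneg (Real.sqrt_nonneg _), ← h1,
    Real.sqrt_sq (norm_nonneg _), div_self]
  intro h0
  rw [h0, zero_pow two_ne_zero] at h1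
  exact hp0.ne h1

/-- The joint description of the normalized sums attached to the twists of `χ` by characters
modulo `p`. -/
theorem exists_nKloos_twist (hp2 : p ≠ 2) (hn : n ≠ 0) {a : ℤ} (ha : (a : ZMod p) ≠ 0)
    {χ : MulChar (ZMod (p ^ (n + 1))) ℂ}
    (h : quadraticChar (ZMod p) (localFreq hn χ ^ 2 - 4 * (a : ZMod p) ^ 2) = 1) :
    ∃ (y : (ZMod p)ˣ) (z : ℂ), (a : ZMod p) * (y + (y⁻¹ : (ZMod p)ˣ)) + localFreq hn χ = 0 ∧
      ‖z‖ = 1 ∧ ∀ ψ : MulChar (ZMod p) ℂ,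
        nKloos (p ^ (n + 1)) a (χ * inflateChar n ψ) = 2 * (ψ y * z).re := by
  have hc : localFreq hn χ ^ 2 - 4 * (a : ZMod p) ^ 2 ≠ 0 := fun h0 => by
    rw [h0, quadraticChar_zero] at h
    exact zero_ne_one h
  obtain ⟨y, hy⟩ := exists_root_of_quadraticChar_eq_one hp2 ha h
  refine ⟨y, _, hy, norm_kloosFiber_div hn ha hc hy, fun ψ => ?_⟩
  rw [nKloos_eq_of_root hn ha (by rwa [localFreq_mul_inflateChar])
    (by rwa [localFreq_mul_inflateChar]), kloosFiber_mul_inflateChar, mul_div_assoc]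

end NormalizedSums

section Moments

/-- The constant term of `(z + z⁻¹) ^ n`. -/
def constTermMoment (n : ℕ) : ℝ := ∑ j ∈ range (n + 1), if 2 * j = n then (n.choose j : ℝ) else 0

theorem constTermMoment_nonneg (n : ℕ) : 0 ≤ constTermMoment n :=
  sum_nonneg fun _ _ => by positivity

theorem constTermMoment_zero : constTermMoment 0 = 1 := by
  simp [constTermMoment]

theorem add_inv_pow_eq_sum {w : ℂ} (hw : w ≠ 0) (n : ℕ) :
    (w + w⁻¹) ^ n = ∑ j ∈ range (n + 1), (n.choose j : ℂ) * w ^ (2 * (j : ℤ) - n) := by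
  rw [add_pow]
  refine sum_congr rfl fun j hj => ?_
  have hj : j ≤ n := Nat.lt_succ_iff.1 (mem_range.1 hj)
  rw [mul_comm, show (2 * (j : ℤ) - n) = j + -((n - j : ℕ) : ℤ) by omega, zpow_add₀ hw, zpow_neg,
    zpow_natCast, zpow_natCast, inv_pow]

theorem two_mul_re_eq_add_inv {w : ℂ} (hw : ‖w‖ = 1) : ((2 * w.re : ℝ) : ℂ) = w + w⁻¹ := by
  rw [inv_eq_conj hw, add_conj]

variable {p : ℕ} [hp : Fact p.Prime]

theorem mulChar_zpow_apply (ψ : MulChar (ZMod p) ℂ) (y : (ZMod p)ˣ) (m : ℤ) :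
    ψ y ^ m = ψ ((y ^ m : (ZMod p)ˣ)) := by
  rw [← MulChar.coe_toUnitHom, ← MulChar.coe_toUnitHom, map_zpow, Units.val_zpow_eq_zpow_val]

theorem mulChar_prod_apply {r : ℕ} (ψ : MulChar (ZMod p) ℂ) (y : Fin r → (ZMod p)ˣ) :
    ∏ i, ψ (y i) = ψ ((∏ i, y i : (ZMod p)ˣ)) := by
  rw [Units.coe_prod, map_prod]

theorem norm_mulChar_apply_unit (ψ : MulChar (ZMod p) ℂ) (y : (ZMod p)ˣ) : ‖ψ y‖ = 1 :=
  DirichletCharacter.unit_norm_eq_one ψ y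

theorem sum_mulChar_apply_unit (u : (ZMod p)ˣ) :
    ∑ ψ : MulChar (ZMod p) ℂ, ψ u = if u = 1 then ((p - 1 : ℕ) : ℂ) else 0 := by
  have := DirichletCharacter.sum_characters_eq ℂ (u : ZMod p)
  rw [Nat.totient_prime hp.out] at this
  simpa using this

/-- Moments of the twists of points on the circle without multiplicative relations. -/
theorem sum_prod_two_mul_re_pow {r : ℕ} (e : Fin r → ℕ) (y : Fin r → (ZMod p)ˣ) (z : Fin r → ℂ)
    (hz : ∀ i, ‖z i‖ = 1)
    (h : ∀ J ∈ Fintype.piFinset (fun i => range (e i + 1)),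
      (fun i => 2 * (J i : ℤ) - e i) ≠ 0 → ∏ i, y i ^ (2 * (J i : ℤ) - e i) ≠ 1) :
    ∑ ψ : MulChar (ZMod p) ℂ, ∏ i, (2 * (ψ (y i) * z i).re) ^ e i =
      ((p - 1 : ℕ) : ℝ) * ∏ i, constTermMoment (e i) := by
  have hw : ∀ (ψ : MulChar (ZMod p) ℂ) i, ‖ψ (y i) * z i‖ = 1 := fun ψ i => by
    rw [norm_mul, norm_mulChar_apply_unit, hz, one_mul]
  have hw0 : ∀ (ψ : MulChar (ZMod p) ℂ) i, ψ (y i) * z i ≠ 0 := fun ψ i h0 => by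
    have := hw ψ i
    rw [h0, norm_zero] at this
    exact zero_ne_one this
  rw [← ofReal_inj]
  rw [ofReal_sum, ofReal_mul, ofReal_prod]
  simp only [ofReal_prod, ofReal_pow, two_mul_re_eq_add_inv (hw _ _),
    add_inv_pow_eq_sum (hw0 _ _)]
  simp only [prod_univ_sum]
  rw [sum_comm]
  have h1 : ∀ J ∈ Fintype.piFinset (fun i => range (e i + 1)),
      ∑ ψ : MulChar (ZMod p) ℂ, ∏ i, ((e i).choose (J i) : ℂ) *
        (ψ (y i) * z i) ^ (2 * (J i : ℤ) - e i) =
      ((p - 1 : ℕ) : ℂ) * ∏ i, if 2 * J i = e i then ((e i).choose (J i) : ℂ) else 0 := by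
    intro J hJ
    have h2 : ∀ ψ : MulChar (ZMod p) ℂ, ∏ i, ((e i).choose (J i) : ℂ) *
        (ψ (y i) * z i) ^ (2 * (J i : ℤ) - e i) =
        (∏ i, ((e i).choose (J i) : ℂ) * z i ^ (2 * (J i : ℤ) - e i)) *
          ψ ((∏ i, y i ^ (2 * (J i : ℤ) - e i) : (ZMod p)ˣ)) := by
      intro ψ
      rw [← mulChar_prod_apply, ← prod_mul_distrib]
      refine prod_congr rfl fun i _ => ?_
      rw [mul_zpow, mulChar_zpow_apply]
      ring
    simp only [h2, ← mul_sum]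
    rw [sum_mulChar_apply_unit, mul_comm]
    by_cases h0 : (fun i => 2 * (J i : ℤ) - e i) = 0
    · have h3 : ∀ i, 2 * (J i : ℤ) - e i = 0 := fun i => congrFun h0 i
      have h4 : ∀ i, 2 * J i = e i := fun i => by have := h3 i; omega
      simp [h3, h4]
    · obtain ⟨i, hi⟩ := Function.ne_iff.1 h0
      rw [if_neg (h J hJ h0), zero_mul, prod_eq_zero (mem_univ i), mul_zero]
      rw [if_neg]
      intro h3
      refine hi ?_
      simp [← h3]
  rw [sum_congr rfl h1, ← mul_sum, ofReal_natCast]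
  have h5 := prod_univ_sum (fun i => range (e i + 1))
    (fun i j => if 2 * j = e i then ((e i).choose j : ℂ) else 0)
  rw [← h5]
  congr 1
  refine prod_congr rfl fun i _ => ?_
  rw [constTermMoment, ofReal_sum]
  refine sum_congr rfl fun j _ => ?_
  split_ifs <;> simp

variable {n : ℕ}

theorem sum_twist_prod_nKloos_pow {r : ℕ} (hp2 : p ≠ 2) (hn : n ≠ 0) {a : Fin r → ℤ}
    (ha : ∀ i, (a i : ZMod p) ≠ 0) (e : Fin r → ℕ) {χ : MulChar (ZMod (p ^ (n + 1))) ℂ}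
    (hc : ∀ i, localFreq hn χ ^ 2 - 4 * (a i : ZMod p) ^ 2 ≠ 0)
    (h : ∀ J ∈ Fintype.piFinset (fun i => range (e i + 1)),
      (fun i => 2 * (J i : ℤ) - e i) ≠ 0 → ∀ y : Fin r → (ZMod p)ˣ,
        (∀ i, 2 * (J i : ℤ) - e i ≠ 0 →
          (a i : ZMod p) * (y i + (y i)⁻¹ : ZMod p) + localFreq hn χ = 0) →
        ∏ i, y i ^ (2 * (J i : ℤ) - e i) ≠ 1) :
    ∑ ψ : MulChar (ZMod p) ℂ, ∏ i, nKloos (p ^ (n + 1)) (a i) (χ * inflateChar n ψ) ^ e i =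
      ((p - 1 : ℕ) : ℝ) * if ∀ i, e i ≠ 0 →
        quadraticChar (ZMod p) (localFreq hn χ ^ 2 - 4 * (a i : ZMod p) ^ 2) = 1
      then ∏ i, constTermMoment (e i) else 0 := by
  split_ifs with hq
  · have hex : ∀ i, ∃ (y : (ZMod p)ˣ) (z : ℂ), (e i ≠ 0 →
        (a i : ZMod p) * (y + (y⁻¹ : (ZMod p)ˣ)) + localFreq hn χ = 0) ∧
        ‖z‖ = 1 ∧ ∀ ψ : MulChar (ZMod p) ℂ,
          nKloos (p ^ (n + 1)) (a i) (χ * inflateChar n ψ) ^ e i = (2 * (ψ y * z).re) ^ e i := by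
      intro i
      by_cases hi : e i = 0
      · exact ⟨1, 1, fun h => absurd hi h, by simp, by simp [hi]⟩
      · obtain ⟨y, z, h1, h2, h3⟩ := exists_nKloos_twist hp2 hn (ha i) (hq i hi)
        exact ⟨y, z, fun _ => h1, h2, fun ψ => by rw [h3]⟩
    choose y z h1 h2 h3 using hex
    simp only [h3]
    refine sum_prod_two_mul_re_pow e y z h2 fun J hJ hm => h J hJ hm y fun i hi => h1 i ?_
    intro h0
    have := Fintype.mem_piFinset.1 hJ i
    rw [h0] at this hi
    simp at this
    simp [this] at hi
  · push Not at hq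
    obtain ⟨i, hi, hi'⟩ := hq
    rw [mul_zero]
    refine sum_eq_zero fun ψ _ => prod_eq_zero (mem_univ i) ?_
    rw [nKloos_eq_zero hn, zero_pow hi]
    · rw [localFreq_mul_inflateChar]; exact hc i
    · rw [localFreq_mul_inflateChar]; exact hi'

theorem sum_localFreq_eq_of_forall_sum_twist (hn : n ≠ 0) {c : ZMod p}
    {f : MulChar (ZMod (p ^ (n + 1))) ℂ → ℝ} {K : ℝ}
    (h : ∀ χ, localFreq hn χ = c →
      ∑ ψ : MulChar (ZMod p) ℂ, f (χ * inflateChar n ψ) = ((p - 1 : ℕ) : ℝ) * K) :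
    ∑ χ with localFreq hn χ = c, f χ = ((p ^ (n - 1) * (p - 1) : ℕ) : ℝ) * K := by
  have hcard : ((p - 1 : ℕ) : ℝ) = Fintype.card (MulChar (ZMod p) ℂ) := by
    have := sum_mulChar_apply_unit (1 : (ZMod p)ˣ)
    simp at this
    exact_mod_cast this.symm
  have hpos : ((p - 1 : ℕ) : ℝ) ≠ 0 := by
    rw [hcard]
    exact_mod_cast Fintype.card_ne_zero
  have h1 : ∀ ψ : MulChar (ZMod p) ℂ, ∑ χ with localFreq hn χ = c, f (χ * inflateChar n ψ) =
      ∑ χ with localFreq hn χ = c, f χ := by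
    intro ψ
    refine sum_bij (fun χ _ => χ * inflateChar n ψ) ?_ ?_ ?_ ?_
    · intro χ hχ
      simpa [localFreq_mul_inflateChar] using hχ
    · intro χ _ χ' _ h
      exact mul_right_cancel h
    · intro χ hχ
      refine ⟨χ * (inflateChar n ψ)⁻¹, ?_, by simp⟩
      rw [mem_filter_univ] at hχ ⊢
      rw [← hχ, ← localFreq_mul_inflateChar hn _ ψ]
      simp
    · intro χ _
      rfl
  have h2 := sum_comm (s := (univ : Finset (MulChar (ZMod p) ℂ)))
    (t := ({χ | localFreq hn χ = c} : Finset (MulChar (ZMod (p ^ (n + 1))) ℂ)))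
    (f := fun ψ χ => f (χ * inflateChar n ψ))
  rw [sum_congr rfl fun ψ _ => h1 ψ, sum_const,
    sum_congr rfl (fun χ hχ => h χ (mem_filter.1 hχ).2), sum_const, card_localFreq_eq, card_univ,
    nsmul_eq_mul, nsmul_eq_mul, ← hcard] at h2
  refine mul_left_cancel₀ hpos ?_
  rw [h2]
  ring

theorem abs_nKloos_le_two (hp2 : p ≠ 2) (hn : n ≠ 0) {a : ℤ} (ha : (a : ZMod p) ≠ 0)
    {χ : MulChar (ZMod (p ^ (n + 1))) ℂ}
    (hc : localFreq hn χ ^ 2 - 4 * (a : ZMod p) ^ 2 ≠ 0) : |nKloos (p ^ (n + 1)) a χ| ≤ 2 := by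
  by_cases h : quadraticChar (ZMod p) (localFreq hn χ ^ 2 - 4 * (a : ZMod p) ^ 2) = 1
  · obtain ⟨y, hy⟩ := exists_root_of_quadraticChar_eq_one hp2 ha h
    rw [nKloos_eq_of_root hn ha hc hy, abs_mul, abs_two]
    have := abs_re_le_norm (kloosFiber (a : ZMod (p ^ (n + 1))) χ y / √(p ^ (n + 1)))
    rw [norm_kloosFiber_div hn ha hc hy] at this
    linarith
  · rw [nKloos_eq_zero hn hc h]
    simp

end Moments

section MomentLimit

theorem intCast_ne_zero_of_natAbs_lt {p : ℕ} {z : ℤ} (hz : z ≠ 0) (h : z.natAbs < p) :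
    (z : ZMod p) ≠ 0 := by
  intro h0
  rw [ZMod.intCast_zmod_eq_zero_iff_dvd] at h0
  exact hz (Int.eq_zero_of_abs_lt_dvd h0 (by rw [Int.abs_eq_natAbs]; omega))

theorem exists_forall_intCast_ne {r : ℕ} (a : Fin r → ℤ) (ha : ∀ i, a i ≠ 0)
    (hdist : ∀ i j, i ≠ j → a i ≠ a j ∧ a i ≠ -a j) :
    ∃ P : ℕ, ∀ p : ℕ, P ≤ p → (∀ i, (a i : ZMod p) ≠ 0) ∧
      ∀ i j, i ≠ j → (a i : ZMod p) ≠ a j ∧ (a i : ZMod p) ≠ -a j := by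
  refine ⟨2 * ∑ i, (a i).natAbs + 1, fun p hp => ?_⟩
  have hle : ∀ i, (a i).natAbs ≤ ∑ i, (a i).natAbs := fun i =>
    single_le_sum (f := fun i => (a i).natAbs) (fun _ _ => Nat.zero_le _) (mem_univ i)
  refine ⟨fun i => intCast_ne_zero_of_natAbs_lt (ha i) (by have := hle i; omega),
    fun i j hij => ⟨fun h => ?_, fun h => ?_⟩⟩
  · refine intCast_ne_zero_of_natAbs_lt (sub_ne_zero.2 (hdist i j hij).1)
      (p := p) (by have := hle i; have := hle j; omega) ?_
    push_cast
    rw [h, sub_self]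
  · refine intCast_ne_zero_of_natAbs_lt (z := a i + a j)
      (fun h => (hdist i j hij).2 (by omega))
      (p := p) (by have := hle i; have := hle j; omega) ?_
    push_cast
    rw [h, neg_add_cancel]

theorem exists_exceptional_set_of_exponents {r : ℕ} (a : Fin r → ℤ) (ha : ∀ i, a i ≠ 0)
    (hdist : ∀ i j, i ≠ j → a i ≠ a j ∧ a i ≠ -a j) (e : Fin r → ℕ) :
    ∃ B P : ℕ, ∀ (p : ℕ) [Fact p.Prime], P ≤ p → (∀ i, (a i : ZMod p) ≠ 0) →
      ∃ E : Finset (ZMod p), #E ≤ B ∧ ∀ c ∉ E,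
        ∀ J ∈ Fintype.piFinset (fun i => range (e i + 1)),
        (fun i => 2 * (J i : ℤ) - e i) ≠ 0 → ∀ y : Fin r → (ZMod p)ˣ,
        (∀ i, 2 * (J i : ℤ) - e i ≠ 0 →
          (a i : ZMod p) * (y i + (y i)⁻¹ : ZMod p) + c = 0) →
        ∏ i, y i ^ (2 * (J i : ℤ) - e i) ≠ 1 := by
  classical
  have h : ∀ J : Fin r → ℕ, ∃ B P : ℕ, ∀ (p : ℕ) [Fact p.Prime], P ≤ p →
      (∀ i, (a i : ZMod p) ≠ 0) →
      ∃ E : Finset (ZMod p), #E ≤ B ∧ ∀ c ∉ E, (fun i => 2 * (J i : ℤ) - e i) ≠ 0 →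
        ∀ y : Fin r → (ZMod p)ˣ, (∀ i, 2 * (J i : ℤ) - e i ≠ 0 →
          (a i : ZMod p) * (y i + (y i)⁻¹ : ZMod p) + c = 0) →
        ∏ i, y i ^ (2 * (J i : ℤ) - e i) ≠ 1 := by
    intro J
    by_cases hJ : (fun i => 2 * (J i : ℤ) - e i) = 0
    · exact ⟨0, 0, fun p _ _ _ => ⟨∅, by simp, fun c _ h => absurd hJ h⟩⟩
    · obtain ⟨B, P, h⟩ := exists_exceptional_set a ha hdist _ hJ
      refine ⟨B, P, fun p _ hp hap => ?_⟩
      obtain ⟨E, hE, hE'⟩ := h p hp hap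
      exact ⟨E, hE, fun c hc _ => hE' c hc⟩
  choose B P h using h
  set T := Fintype.piFinset (fun i => range (e i + 1))
  refine ⟨∑ J ∈ T, B J, ∑ J ∈ T, P J, fun p _ hp hap => ?_⟩
  have hE : ∀ J, ∃ E : Finset (ZMod p), J ∈ T → #E ≤ B J ∧ ∀ c ∉ E,
      (fun i => 2 * (J i : ℤ) - e i) ≠ 0 →
        ∀ y : Fin r → (ZMod p)ˣ, (∀ i, 2 * (J i : ℤ) - e i ≠ 0 →
          (a i : ZMod p) * (y i + (y i)⁻¹ : ZMod p) + c = 0) →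
        ∏ i, y i ^ (2 * (J i : ℤ) - e i) ≠ 1 := by
    intro J
    by_cases hJ : J ∈ T
    · obtain ⟨E, hE⟩ := h J p ((single_le_sum (f := P) (fun _ _ => Nat.zero_le _) hJ).trans hp) hap
      exact ⟨E, fun _ => hE⟩
    · exact ⟨∅, fun h => absurd h hJ⟩
  choose E hE using hE
  refine ⟨T.biUnion E, card_biUnion_le.trans (sum_le_sum fun J hJ => (hE J hJ).1),
    fun c hc J hJ => (hE J hJ).2 c fun hcE => hc ?_⟩
  exact mem_biUnion.2 ⟨J, hJ, hcE⟩

variable {p n : ℕ} [hp : Fact p.Prime]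

theorem card_degenerate_le {r : ℕ} (A : Fin r → ZMod p) :
    #{c : ZMod p | ∃ i, c ^ 2 - 4 * A i ^ 2 = 0} ≤ 2 * r := by
  have hsub : ({c : ZMod p | ∃ i, c ^ 2 - 4 * A i ^ 2 = 0} : Finset (ZMod p)) ⊆
      (univ : Finset (Fin r)).biUnion fun i => {2 * A i, -(2 * A i)} := by
    intro c hc
    obtain ⟨i, hi⟩ := (mem_filter_univ _).1 hc
    refine mem_biUnion.2 ⟨i, mem_univ i, ?_⟩
    have : (c - 2 * A i) * (c + 2 * A i) = 0 := by linear_combination hi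
    rcases mul_eq_zero.1 this with h | h
    · simp [sub_eq_zero.1 h]
    · simp [eq_neg_of_add_eq_zero_left h]
  refine (card_le_card hsub).trans
      ((card_biUnion_le_card_mul _ _ 2 fun i _ => card_le_two).trans ?_)
  rw [card_univ, Fintype.card_fin, mul_comm]

/-- Characters for which some normalized sum is large are rare. -/
theorem card_two_lt_abs_nKloos_le (hp2 : p ≠ 2) (hn : n ≠ 0) {r : ℕ} {a : Fin r → ℤ}
    (ha : ∀ i, (a i : ZMod p) ≠ 0) :
    #{χ : MulChar (ZMod (p ^ (n + 1))) ℂ | ¬∀ i, |nKloos (p ^ (n + 1)) (a i) χ| ≤ 2} ≤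
      2 * r * (p ^ (n - 1) * (p - 1)) := by
  classical
  set D : Finset (ZMod p) := {c : ZMod p | ∃ i, c ^ 2 - 4 * (a i : ZMod p) ^ 2 = 0}
  have hsub : ({χ | ¬∀ i, |nKloos (p ^ (n + 1)) (a i) χ| ≤ 2} :
      Finset (MulChar (ZMod (p ^ (n + 1))) ℂ)) ⊆
      D.biUnion fun c => {χ | localFreq hn χ = c} := by
    intro χ hχ
    have hχ := (mem_filter_univ _).1 hχ
    refine mem_biUnion.2 ⟨localFreq hn χ, ?_, by simp⟩
    rw [mem_filter_univ]
    by_contra! h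
    exact hχ fun i => abs_nKloos_le_two hp2 hn (ha i) (h i)
  refine (card_le_card hsub).trans ((card_biUnion_le_card_mul _ _ _ fun c _ =>
    (card_localFreq_eq hn c).le).trans ?_)
  exact Nat.mul_le_mul_right _ (card_degenerate_le _)

theorem card_localFreq_div (hn : n ≠ 0) :
    ((p ^ (n - 1) * (p - 1) : ℕ) : ℝ) / p ^ (n + 1) = (p - 1) / p ^ 2 := by
  obtain ⟨m, rfl⟩ := Nat.exists_eq_succ_of_ne_zero hn
  have h0 : (p : ℝ) ≠ 0 := by exact_mod_cast hp.out.ne_zero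
  rw [Nat.cast_mul, Nat.cast_pred hp.out.pos, Nat.succ_sub_one, Nat.cast_pow, Nat.succ_eq_add_one]
  field_simp
  ring

/-- The moments over the non-degenerate characters, up to an error from the exceptional
residues. -/
theorem abs_sum_prod_nKloos_pow_sub_le (hp2 : p ≠ 2) (hn : n ≠ 0) {r : ℕ} {a : Fin r → ℤ}
    (ha : ∀ i, (a i : ZMod p) ≠ 0) (e : Fin r → ℕ) {E : Finset (ZMod p)}
    (hE : ∀ c ∉ E, ∀ J ∈ Fintype.piFinset (fun i => range (e i + 1)),
        (fun i => 2 * (J i : ℤ) - e i) ≠ 0 → ∀ y : Fin r → (ZMod p)ˣ,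
        (∀ i, 2 * (J i : ℤ) - e i ≠ 0 →
          (a i : ZMod p) * (y i + (y i)⁻¹ : ZMod p) + c = 0) →
        ∏ i, y i ^ (2 * (J i : ℤ) - e i) ≠ 1) :
    |∑ χ : MulChar (ZMod (p ^ (n + 1))) ℂ with ∀ i, |nKloos (p ^ (n + 1)) (a i) χ| ≤ 2,
        ∏ i, nKloos (p ^ (n + 1)) (a i) χ ^ e i -
      ((p ^ (n - 1) * (p - 1) : ℕ) : ℝ) * ((∏ i, constTermMoment (e i)) *
        #{c : ZMod p | ∀ i ∈ ({i | e i ≠ 0} : Finset (Fin r)),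
          quadraticChar (ZMod p) (c ^ 2 - 4 * (a i : ZMod p) ^ 2) = 1})| ≤
      ((p ^ (n - 1) * (p - 1) : ℕ) : ℝ) *
        ((2 * r + #E) * (2 ^ (∑ i, e i) + ∏ i, constTermMoment (e i))) := by
  classical
  set Γ : ℝ := ((p ^ (n - 1) * (p - 1) : ℕ) : ℝ) with hΓ
  set X := ∏ i, constTermMoment (e i) with hX
  have hX0 : 0 ≤ X := prod_nonneg fun i _ => constTermMoment_nonneg _
  have hΓ0 : 0 ≤ Γ := Nat.cast_nonneg _
  set D : Finset (ZMod p) := {c : ZMod p | ∃ i, c ^ 2 - 4 * (a i : ZMod p) ^ 2 = 0} with hD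
  set f : MulChar (ZMod (p ^ (n + 1))) ℂ → ℝ := fun χ =>
    if ∀ i, |nKloos (p ^ (n + 1)) (a i) χ| ≤ 2 then ∏ i, nKloos (p ^ (n + 1)) (a i) χ ^ e i else 0
    with hf
  have hfle : ∀ χ, |f χ| ≤ 2 ^ (∑ i, e i) := by
    intro χ
    simp only [hf]
    split_ifs with h
    · rw [abs_prod, ← prod_pow_eq_pow_sum]
      refine prod_le_prod (fun _ _ => abs_nonneg _) fun i _ => ?_
      rw [abs_pow]
      exact pow_le_pow_left₀ (abs_nonneg _) (h i) _
    · rw [abs_zero]; positivity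
  set q : ZMod p → ℝ := fun c => if ∀ i, e i ≠ 0 →
        quadraticChar (ZMod p) (c ^ 2 - 4 * (a i : ZMod p) ^ 2) = 1 then X else 0 with hq
  have hqle : ∀ c, |q c| ≤ X := by
    intro c
    simp only [hq]
    split_ifs
    · rw [abs_of_nonneg hX0]
    · rwa [abs_zero]
  have hqsum : ∑ c, q c = X * #{c : ZMod p | ∀ i ∈ ({i | e i ≠ 0} : Finset (Fin r)),
          quadraticChar (ZMod p) (c ^ 2 - 4 * (a i : ZMod p) ^ 2) = 1} := by
    rw [mul_comm, ← nsmul_eq_mul, ← sum_const, sum_filter]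
    refine sum_congr rfl fun c _ => ?_
    simp only [hq, mem_filter_univ]
  have hgood : ∀ c ∉ D ∪ E, ∑ χ with localFreq hn χ = c, f χ = Γ * q c := by
    intro c hc
    rw [mem_union, not_or] at hc
    have hcD : ∀ i, c ^ 2 - 4 * (a i : ZMod p) ^ 2 ≠ 0 := by
      have := hc.1
      rw [mem_filter_univ] at this
      push Not at this
      exact this
    refine sum_localFreq_eq_of_forall_sum_twist hn fun χ hχ => ?_
    subst hχ
    rw [← sum_twist_prod_nKloos_pow hp2 hn ha e hcD (hE _ hc.2)]
    refine sum_congr rfl fun ψ _ => ?_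
    simp only [hf]
    rw [if_pos]
    exact fun i => abs_nKloos_le_two hp2 hn (ha i) (by
      rw [localFreq_mul_inflateChar]; exact hcD i)
  have hbad : ∀ c, |∑ χ with localFreq hn χ = c, f χ - Γ * q c| ≤
      Γ * (2 ^ (∑ i, e i) + X) := by
    intro c
    refine (abs_sub _ _).trans ?_
    rw [mul_add]
    refine add_le_add ?_ ?_
    · refine (abs_sum_le_sum_abs _ _).trans ((sum_le_card_nsmul _ _ _ fun χ _ => hfle χ).trans ?_)
      rw [card_localFreq_eq, nsmul_eq_mul]
    · rw [abs_mul, abs_of_nonneg hΓ0]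
      exact mul_le_mul_of_nonneg_left (hqle c) hΓ0
  rw [sum_filter, ← hqsum, mul_sum, ← sum_fiberwise univ (localFreq hn), ← sum_sub_distrib]
  have hsub : ∑ c, (∑ χ with localFreq hn χ = c, f χ - Γ * q c) =
      ∑ c ∈ D ∪ E, (∑ χ with localFreq hn χ = c, f χ - Γ * q c) :=
    (sum_subset (subset_univ _) fun c _ hc => by rw [hgood c hc, sub_self]).symm
  change |∑ c, (∑ χ with localFreq hn χ = c, f χ - Γ * q c)| ≤ _
  rw [hsub]
  refine (abs_sum_le_sum_abs _ _).trans ((sum_le_card_nsmul _ _ _ fun c _ => hbad c).trans ?_)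
  rw [nsmul_eq_mul]
  have hcard : ((#(D ∪ E) : ℕ) : ℝ) ≤ 2 * r + #E := by
    have := (card_union_le D E).trans
      (Nat.add_le_add_right (card_degenerate_le fun i => (a i : ZMod p)) _)
    exact_mod_cast this
  calc (#(D ∪ E) : ℝ) * (Γ * (2 ^ (∑ i, e i) + X))
      ≤ (2 * r + #E) * (Γ * (2 ^ (∑ i, e i) + X)) :=
        mul_le_mul_of_nonneg_right hcard (by positivity)
    _ = _ := by ring

end MomentLimit

section MomentConvergence

theorem exists_forall_abs_moment_sub_le {n : ℕ} (hn : n ≠ 0) {r : ℕ} (a : Fin r → ℤ)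
    (ha : ∀ i, a i ≠ 0) (hdist : ∀ i j, i ≠ j → a i ≠ a j ∧ a i ≠ -a j) (e : Fin r → ℕ)
    {ε : ℝ} (hε : 0 < ε) :
    ∃ P : ℕ, ∀ (p : ℕ) [Fact p.Prime], P ≤ p →
      |1 / (p : ℝ) ^ (n + 1) *
        ∑ χ : MulChar (ZMod (p ^ (n + 1))) ℂ with ∀ i, |nKloos (p ^ (n + 1)) (a i) χ| ≤ 2,
          ∏ i, nKloos (p ^ (n + 1)) (a i) χ ^ e i -
        (∏ i, constTermMoment (e i)) / 2 ^ #{i | e i ≠ 0}| ≤ ε := by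
  set X := ∏ i, constTermMoment (e i) with hX
  have hX0 : 0 ≤ X := prod_nonneg fun i _ => constTermMoment_nonneg _
  obtain ⟨P₁, hP₁⟩ := exists_forall_intCast_ne a ha hdist
  obtain ⟨B, P₂, hP₂⟩ := exists_exceptional_set_of_exponents a ha hdist e
  obtain ⟨P₃, hP₃⟩ := exists_forall_card_quadraticChar_eq_one r (ε := ε / (2 * (X + 1)))
    (by positivity)
  set K : ℝ := (2 * r + B) * (2 ^ (∑ i, e i) + X) with hK
  obtain ⟨N, hN⟩ := exists_nat_ge (2 * (K + X) / ε)
  refine ⟨max (max P₁ P₂) (max P₃ (max N 3)), fun p hp hle => ?_⟩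
  simp only [max_le_iff] at hle
  obtain ⟨⟨h1, h2⟩, h3, h4, h5⟩ := hle
  obtain ⟨hap, hdp⟩ := hP₁ p h1
  obtain ⟨E, hEB, hE⟩ := hP₂ p h2 hap
  have hG := hP₃ p h3 (fun i => (a i : ZMod p)) hap hdp {i | e i ≠ 0}
  have hM := abs_sum_prod_nKloos_pow_sub_le (by omega : p ≠ 2) hn hap e hE
  have hdiv := card_localFreq_div (p := p) hn
  set Y := ∑ χ : MulChar (ZMod (p ^ (n + 1))) ℂ with ∀ i, |nKloos (p ^ (n + 1)) (a i) χ| ≤ 2,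
          ∏ i, nKloos (p ^ (n + 1)) (a i) χ ^ e i
  have hGp : #{c : ZMod p | ∀ i ∈ ({i | e i ≠ 0} : Finset (Fin r)),
          quadraticChar (ZMod p) (c ^ 2 - 4 * (a i : ZMod p) ^ 2) = 1} ≤ p :=
    (card_le_univ _).trans (ZMod.card p).le
  set G := #{c : ZMod p | ∀ i ∈ ({i | e i ≠ 0} : Finset (Fin r)),
          quadraticChar (ZMod p) (c ^ 2 - 4 * (a i : ZMod p) ^ 2) = 1}
  set Γ : ℝ := ((p ^ (n - 1) * (p - 1) : ℕ) : ℝ)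
  set q : ℝ := (p : ℝ) ^ (n + 1)
  set t : ℝ := 2 ^ #{i | e i ≠ 0}
  have ht : 0 < t := by positivity
  have hp1 : (1 : ℝ) ≤ p := by exact_mod_cast hp.out.one_le
  have hp0 : (0 : ℝ) < p := by linarith
  have hq : 0 < q := by positivity
  have hΓ0 : 0 ≤ Γ := Nat.cast_nonneg _
  have hΓq : Γ / q ≤ 1 / p := by
    rw [hdiv, div_le_div_iff₀ (by positivity) hp0]
    nlinarith
  have hGp' : (G : ℝ) ≤ p := by exact_mod_cast hGp
  have hG0 : (0 : ℝ) ≤ G := Nat.cast_nonneg _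
  have hEB' : ((#E : ℕ) : ℝ) ≤ B := by exact_mod_cast hEB
  have hA : |Y / q - Γ / q * (X * G)| ≤ K / p := by
    rw [show Y / q - Γ / q * (X * G) = (Y - Γ * (X * G)) / q by ring, abs_div, abs_of_pos hq]
    calc |Y - Γ * (X * G)| / q ≤ Γ * ((2 * r + #E) * (2 ^ (∑ i, e i) + X)) / q :=
          div_le_div_of_nonneg_right hM hq.le
      _ = Γ / q * ((2 * r + #E) * (2 ^ (∑ i, e i) + X)) := by ring
      _ ≤ 1 / p * K := by
        refine mul_le_mul hΓq ?_ (by positivity) (by positivity)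
        rw [hK]
        gcongr
      _ = K / p := by ring
  have hB : |Γ / q * G - 1 / t| ≤ ε / (2 * (X + 1)) + 1 / p := by
    have h6 : Γ / q * G - 1 / t = (G - p / t) / p - G / p ^ 2 := by
      rw [hdiv]
      field_simp
      ring
    rw [h6]
    refine (abs_sub _ _).trans (add_le_add ?_ ?_)
    · rw [abs_div, abs_of_pos hp0, div_le_iff₀ hp0]
      exact hG
    · rw [abs_of_nonneg (by positivity), div_le_div_iff₀ (by positivity) hp0]
      nlinarith
  have hN' : 2 * (K + X) / ε ≤ p := hN.trans (by exact_mod_cast h4)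
  have hfin : (K + X) / p ≤ ε / 2 := by
    rw [div_le_iff₀ hε] at hN'
    rw [div_le_iff₀ hp0]
    linarith
  have hXε : X * (ε / (2 * (X + 1))) ≤ ε / 2 := by
    rw [mul_div_assoc', div_le_div_iff₀ (by positivity) two_pos]
    nlinarith
  calc |1 / q * Y - X / t|
      = |(Y / q - Γ / q * (X * G)) + X * (Γ / q * G - 1 / t)| := by congr 1; ring
    _ ≤ |Y / q - Γ / q * (X * G)| + X * |Γ / q * G - 1 / t| := by
        refine (abs_add_le _ _).trans ?_
        rw [abs_mul, abs_of_nonneg hX0]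
    _ ≤ K / p + X * (ε / (2 * (X + 1)) + 1 / p) := by gcongr
    _ = (K + X) / p + X * (ε / (2 * (X + 1))) := by ring
    _ ≤ ε := by linarith

theorem card_two_lt_abs_nKloos_div_le {p : ℕ} [Fact p.Prime] {n : ℕ} (hp2 : p ≠ 2) (hn : n ≠ 0)
    {r : ℕ} {a : Fin r → ℤ} (ha : ∀ i, (a i : ZMod p) ≠ 0) :
    1 / (p : ℝ) ^ (n + 1) *
      #{χ : MulChar (ZMod (p ^ (n + 1))) ℂ | ¬∀ i, |nKloos (p ^ (n + 1)) (a i) χ| ≤ 2} ≤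
      2 * r / p := by
  have hp0 : (0 : ℝ) < p := by exact_mod_cast (Fact.out : p.Prime).pos
  have h : ((#{χ : MulChar (ZMod (p ^ (n + 1))) ℂ |
      ¬∀ i, |nKloos (p ^ (n + 1)) (a i) χ| ≤ 2} : ℕ) : ℝ) ≤
      2 * r * ((p ^ (n - 1) * (p - 1) : ℕ) : ℝ) := by
    exact_mod_cast card_two_lt_abs_nKloos_le hp2 hn ha
  calc _ ≤ 1 / (p : ℝ) ^ (n + 1) * (2 * r * ((p ^ (n - 1) * (p - 1) : ℕ) : ℝ)) := by gcongr
    _ = 2 * r * (((p ^ (n - 1) * (p - 1) : ℕ) : ℝ) / p ^ (n + 1)) := by ring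
    _ ≤ 2 * r * (1 / p) := by
        rw [card_localFreq_div hn]
        gcongr 2 * r * ?_
        rw [div_le_div_iff₀ (by positivity) hp0]
        nlinarith
    _ = 2 * r / p := by ring

end MomentConvergence

section LimitMeasure

theorem integral_cos_int_mul (m : ℤ) :
    ∫ θ in (0 : ℝ)..Real.pi, Real.cos (m * θ) = if m = 0 then Real.pi else 0 := by
  split_ifs with h
  · simp [h]
  · have hm : (m : ℝ) ≠ 0 := by exact_mod_cast h
    rw [intervalIntegral.integral_comp_mul_left (fun x => Real.cos x) hm, integral_cos,
      Real.sin_int_mul_pi]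
    simp

theorem two_mul_cos_pow_eq_sum (θ : ℝ) (n : ℕ) :
    (2 * Real.cos θ) ^ n =
      ∑ j ∈ range (n + 1), (n.choose j : ℝ) * Real.cos ((2 * (j : ℤ) - n : ℤ) * θ) := by
  have hw : (2 * Real.cos θ : ℝ) =
      Complex.exp (θ * I) + (Complex.exp (θ * I))⁻¹ := by
    rw [← Complex.exp_neg, Complex.ofReal_mul, Complex.ofReal_cos, Complex.cos]
    push_cast
    ring_nf
  have h := add_inv_pow_eq_sum (Complex.exp_ne_zero (θ * I)) n
  rw [← hw, ← Complex.ofReal_pow] at h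
  have h2 := congrArg Complex.re h
  rw [Complex.ofReal_re, Complex.re_sum] at h2
  rw [h2]
  refine sum_congr rfl fun j _ => ?_
  rw [← Complex.exp_int_mul, ← Complex.ofReal_natCast (n.choose j), Complex.re_ofReal_mul]
  congr 1
  rw [← mul_assoc, ← Complex.ofReal_intCast, ← Complex.ofReal_mul, Complex.exp_ofReal_mul_I_re]

theorem integral_two_mul_cos_pow (n : ℕ) :
    ∫ θ in (0 : ℝ)..Real.pi, (2 * Real.cos θ) ^ n = Real.pi * constTermMoment n := by
  simp_rw [two_mul_cos_pow_eq_sum]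
  rw [intervalIntegral.integral_finsetSum
    fun j _ => (by fun_prop : Continuous _).intervalIntegrable _ _, constTermMoment, mul_sum]
  refine sum_congr rfl fun j _ => ?_
  rw [intervalIntegral.integral_const_mul, integral_cos_int_mul]
  have : (2 * (j : ℤ) - n = 0) ↔ 2 * j = n := by omega
  simp only [this]
  split_ifs <;> ring

theorem image_two_mul_cos_Ioo :
    (fun θ => 2 * Real.cos θ) '' Set.Ioo 0 Real.pi = Set.Ioo (-2 : ℝ) 2 := by
  ext x
  constructor
  · rintro ⟨θ, ⟨h0, hπ⟩, rfl⟩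
    have h1 := Real.strictAntiOn_cos ⟨le_rfl, Real.pi_pos.le⟩ ⟨h0.le, hπ.le⟩ h0
    have h2 := Real.strictAntiOn_cos ⟨h0.le, hπ.le⟩ ⟨Real.pi_pos.le, le_rfl⟩ hπ
    rw [Real.cos_zero] at h1
    rw [Real.cos_pi] at h2
    constructor <;> dsimp only <;> linarith
  · rintro ⟨h1, h2⟩
    refine ⟨Real.arccos (x / 2), ⟨Real.arccos_pos.2 (by linarith), ?_⟩, ?_⟩
    · refine lt_of_le_of_ne (Real.arccos_le_pi _) fun h => ?_
      rw [Real.arccos_eq_pi] at h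
      linarith
    · dsimp only
      rw [Real.cos_arccos (by linarith) (by linarith)]
      ring

/-- The absolutely continuous part of `muK` is the distribution of `2 cos θ` for `θ` uniform on
`(0, π)`, with total mass `1/2`. -/
theorem withDensity_eq_smul_map_two_mul_cos :
    (volume.restrict (Set.Ioo (-2 : ℝ) 2)).withDensity
      (fun x => ENNReal.ofReal (1 / (2 * Real.pi * Real.sqrt (4 - x ^ 2)))) =
    ENNReal.ofReal (1 / (2 * Real.pi)) •
      (volume.restrict (Set.Ioo 0 Real.pi)).map (fun θ => 2 * Real.cos θ) := by
  have hcos : Measurable fun θ : ℝ => 2 * Real.cos θ := by fun_prop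
  ext s hs
  rw [withDensity_apply _ hs, Measure.smul_apply, Measure.map_apply hcos hs, smul_eq_mul,
    ← lintegral_indicator hs, ← image_two_mul_cos_Ioo,
    lintegral_image_eq_lintegral_abs_deriv_mul (f' := fun θ => 2 * -Real.sin θ) measurableSet_Ioo
      (fun θ _ => ((Real.hasDerivAt_cos θ).const_mul 2).hasDerivWithinAt)
      (fun θ hθ φ hφ h => Real.injOn_cos (Set.Ioo_subset_Icc_self hθ)
        (Set.Ioo_subset_Icc_self hφ) (mul_left_cancel₀ two_ne_zero h))]
  rw [← lintegral_indicator_one (hcos hs),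
    ← lintegral_const_mul _ (measurable_one.indicator (hcos hs))]
  refine setLIntegral_congr_fun measurableSet_Ioo fun θ hθ => ?_
  have hsin := Real.sin_pos_of_mem_Ioo hθ
  by_cases hmem : 2 * Real.cos θ ∈ s
  · have hpre : θ ∈ (fun θ => 2 * Real.cos θ) ⁻¹' s := hmem
    have hsqrt : Real.sqrt (4 - (2 * Real.cos θ) ^ 2) = 2 * Real.sin θ := by
      rw [← Real.sqrt_sq (by positivity : 0 ≤ 2 * Real.sin θ)]
      congr 1
      linear_combination (-4) * Real.sin_sq_add_cos_sq θ
    have habs : |2 * -Real.sin θ| = 2 * Real.sin θ := by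
      rw [mul_neg, abs_neg, abs_of_pos (by positivity)]
    rw [Set.indicator_of_mem hmem, Set.indicator_of_mem hpre, hsqrt, habs,
      ← ENNReal.ofReal_mul (by positivity), Pi.one_apply, mul_one]
    congr 1
    field_simp
  · have hpre : θ ∉ (fun θ => 2 * Real.cos θ) ⁻¹' s := hmem
    rw [Set.indicator_of_notMem hmem, Set.indicator_of_notMem hpre,
      mul_zero, mul_zero]

theorem muK_eq : muK = (1/2 : ENNReal) • Measure.dirac 0 + ENNReal.ofReal (1 / (2 * Real.pi)) •
      (volume.restrict (Set.Ioo 0 Real.pi)).map (fun θ => 2 * Real.cos θ) := by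
  rw [muK, withDensity_eq_smul_map_two_mul_cos]

instance isProbabilityMeasure_muK : IsProbabilityMeasure muK := by
  constructor
  rw [muK_eq, Measure.add_apply, Measure.smul_apply, Measure.smul_apply,
    Measure.map_apply (by fun_prop) MeasurableSet.univ]
  simp only [measure_univ, Set.preimage_univ, Measure.restrict_apply_univ, Real.volume_Ioo,
    smul_eq_mul, sub_zero, mul_one]
  rw [← ENNReal.ofReal_mul (by positivity), show 1 / (2 * Real.pi) * Real.pi = 1 / 2 by
    field_simp, ENNReal.ofReal_div_of_pos two_pos, ENNReal.ofReal_one, ENNReal.ofReal_ofNat]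
  exact ENNReal.add_halves 1

theorem ae_muK_mem_Icc : ∀ᵐ x ∂muK, x ∈ Set.Icc (-2 : ℝ) 2 := by
  rw [muK, ae_add_measure_iff]
  constructor
  · exact Measure.ae_smul_measure ((ae_dirac_iff measurableSet_Icc).2 (by norm_num)) _
  · refine withDensity_absolutelyContinuous _ _ |>.ae_le ?_
    filter_upwards [ae_restrict_mem measurableSet_Ioo] with x hx
    exact Set.Ioo_subset_Icc_self hx

theorem integrable_pow_muK (n : ℕ) : Integrable (fun x : ℝ => x ^ n) muK := by
  refine Integrable.of_bound (by fun_prop) (2 ^ n) ?_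
  filter_upwards [ae_muK_mem_Icc] with x hx
  rw [norm_pow]
  exact pow_le_pow_left₀ (norm_nonneg _) (abs_le.2 hx) _

theorem integral_pow_muK (n : ℕ) :
    ∫ x, x ^ n ∂muK = if n = 0 then 1 else constTermMoment n / 2 := by
  have hint := integrable_pow_muK n
  rw [muK_eq] at hint ⊢
  rw [integrable_add_measure] at hint
  rw [integral_add_measure hint.1 hint.2, integral_smul_measure, integral_smul_measure,
    integral_dirac, integral_map (by fun_prop) (by fun_prop), ← integral_Ioc_eq_integral_Ioo,
    ← intervalIntegral.integral_of_le Real.pi_pos.le, integral_two_mul_cos_pow,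
    ENNReal.toReal_ofReal (by positivity)]
  have : (1 / 2 : ENNReal).toReal = 1 / 2 := by simp
  rw [this]
  split_ifs with h
  · subst h
    rw [constTermMoment_zero, smul_eq_mul, smul_eq_mul]
    field_simp
    norm_num
  · rw [zero_pow h, smul_eq_mul, smul_eq_mul]
    field_simp
    ring

theorem integral_prod_pow_pi_muK {r : ℕ} (e : Fin r → ℕ) :
    ∫ x, ∏ i, x i ^ e i ∂(Measure.pi fun _ : Fin r => muK) =
      (∏ i, constTermMoment (e i)) / 2 ^ #{i | e i ≠ 0} := by
  rw [integral_fintype_prod_eq_prod (fun i (x : ℝ) => x ^ e i)]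
  simp_rw [integral_pow_muK]
  rw [eq_div_iff (by positivity), ← prod_const, prod_filter, ← prod_mul_distrib]
  refine prod_congr rfl fun i _ => ?_
  by_cases h : e i = 0
  · simp [h, constTermMoment_zero]
  · simp [h]

theorem ae_pi_muK_mem_Icc {r : ℕ} :
    ∀ᵐ x ∂(Measure.pi fun _ : Fin r => muK), ∀ i, x i ∈ Set.Icc (-2 : ℝ) 2 := by
  rw [ae_all_iff]
  exact fun i => (Measure.quasiMeasurePreserving_eval _ i).ae ae_muK_mem_Icc

end LimitMeasure

section Weierstrass

variable {r : ℕ}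

theorem exists_mvPolynomial_near (g : C(Fin r → ℝ, ℝ)) {ε : ℝ} (hε : 0 < ε) :
    ∃ P : MvPolynomial (Fin r) ℝ, ∀ x : Fin r → ℝ, (∀ i, x i ∈ Set.Icc (-2 : ℝ) 2) →
      |MvPolynomial.eval x P - g x| ≤ ε := by
  let φ : MvPolynomial (Fin r) ℝ →ₐ[ℝ] C(Fin r → ℝ, ℝ) :=
    MvPolynomial.aeval fun i => ⟨fun x => x i, continuous_apply i⟩
  have hφ : ∀ P x, φ P x = MvPolynomial.eval x P := by
    intro P x
    induction P using MvPolynomial.induction_on with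
    | C a => simp [φ, Algebra.algebraMap_eq_smul_one]
    | add P Q hP hQ => rw [map_add, ContinuousMap.add_apply, hP, hQ, map_add]
    | mul_X P i hP =>
      rw [map_mul, ContinuousMap.mul_apply, hP, map_mul, MvPolynomial.eval_X]
      simp [φ]
  have hsep : φ.range.SeparatesPoints := by
    intro x y hxy
    obtain ⟨i, hi⟩ := Function.ne_iff.1 hxy
    refine ⟨_, ⟨φ (MvPolynomial.X i), ⟨_, rfl⟩, rfl⟩, ?_⟩
    change φ (MvPolynomial.X i) x ≠ φ (MvPolynomial.X i) y
    rwa [hφ, hφ, MvPolynomial.eval_X, MvPolynomial.eval_X]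
  obtain ⟨_, ⟨P, rfl⟩, hP⟩ :=
    ContinuousMap.exists_mem_subalgebra_near_continuous_of_isCompact_of_separatesPoints hsep g
      (isCompact_univ_pi fun _ : Fin r => isCompact_Icc (a := (-2 : ℝ)) (b := 2)) hε
  refine ⟨P, fun x hx => ?_⟩
  rw [← hφ, ← Real.norm_eq_abs]
  exact (hP x fun i _ => hx i).le

theorem Continuous.integrable_of_ae_mem_box {ν : Measure (Fin r → ℝ)} [IsFiniteMeasure ν]
    (hν : ∀ᵐ x ∂ν, ∀ i, x i ∈ Set.Icc (-2 : ℝ) 2) {f : (Fin r → ℝ) → ℝ} (hf : Continuous f) :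
    Integrable f ν := by
  obtain ⟨C, hC⟩ := (isCompact_univ_pi fun _ : Fin r =>
    isCompact_Icc (a := (-2 : ℝ)) (b := 2)).exists_bound_of_continuousOn hf.continuousOn
  refine Integrable.of_bound hf.aestronglyMeasurable C ?_
  filter_upwards [hν] with x hx
  exact hC x fun i _ => hx i

/-- Convergence of all the moments implies weak convergence for weighted point masses in the box
`[-2, 2]^r`. -/
theorem tendsto_sum_of_tendsto_moments {l : Filter ℕ} {ι : ℕ → Type*} (S : ∀ n, Finset (ι n))
    (X : ∀ n, ι n → Fin r → ℝ) (w : ℕ → ℝ) (hw : ∀ n, 0 ≤ w n)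
    (hwS : ∀ᶠ n in l, w n * #(S n) ≤ 1)
    (hX : ∀ n, ∀ s ∈ S n, ∀ i, X n s i ∈ Set.Icc (-2 : ℝ) 2)
    {ν : Measure (Fin r → ℝ)} [IsProbabilityMeasure ν]
    (hν : ∀ᵐ x ∂ν, ∀ i, x i ∈ Set.Icc (-2 : ℝ) 2)
    (hmom : ∀ e : Fin r → ℕ, Filter.Tendsto (fun n => w n * ∑ s ∈ S n, ∏ i, X n s i ^ e i) l
      (nhds (∫ x, ∏ i, x i ^ e i ∂ν))) (g : C(Fin r → ℝ, ℝ)) :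
    Filter.Tendsto (fun n => w n * ∑ s ∈ S n, g (X n s)) l (nhds (∫ x, g x ∂ν)) := by
  have hpoly : ∀ P : MvPolynomial (Fin r) ℝ,
      Filter.Tendsto (fun n => w n * ∑ s ∈ S n, MvPolynomial.eval (X n s) P) l
        (nhds (∫ x, MvPolynomial.eval x P ∂ν)) := by
    intro P
    simp_rw [MvPolynomial.eval_eq']
    rw [integral_finsetSum _ fun d _ =>
      Continuous.integrable_of_ae_mem_box hν (by fun_prop)]
    simp_rw [integral_const_mul]
    have := tendsto_finsetSum P.support fun d _ => (hmom d).const_mul (P.coeff d)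
    refine this.congr fun n => ?_
    rw [sum_comm, mul_sum]
    refine sum_congr rfl fun d _ => ?_
    rw [← mul_sum]
    ring
  rw [Metric.tendsto_nhds]
  intro ε hε
  obtain ⟨P, hP⟩ := exists_mvPolynomial_near g (ε := ε / 4) (by positivity)
  have hintP : Integrable (fun x => MvPolynomial.eval x P) ν :=
    Continuous.integrable_of_ae_mem_box hν (MvPolynomial.continuous_eval P)
  have hintg : Integrable (fun x => g x) ν :=
    Continuous.integrable_of_ae_mem_box hν (by fun_prop)
  have h1 : |∫ x, MvPolynomial.eval x P ∂ν - ∫ x, g x ∂ν| ≤ ε / 4 := by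
    rw [← integral_sub hintP hintg, ← Real.norm_eq_abs]
    refine (norm_integral_le_of_norm_le_const (C := ε / 4) ?_).trans (by simp)
    filter_upwards [hν] with x hx using hP x hx
  filter_upwards [(Metric.tendsto_nhds.1 (hpoly P)) (ε / 4) (by positivity), hwS] with n hn hwn
  have h2 : |w n * ∑ s ∈ S n, MvPolynomial.eval (X n s) P - w n * ∑ s ∈ S n, g (X n s)| ≤
      ε / 4 := by
    rw [← mul_sub, ← sum_sub_distrib, abs_mul, abs_of_nonneg (hw n)]
    calc w n * |∑ s ∈ S n, (MvPolynomial.eval (X n s) P - g (X n s))|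
        ≤ w n * (#(S n) * (ε / 4)) := by
          refine mul_le_mul_of_nonneg_left ((abs_sum_le_sum_abs _ _).trans ?_) (hw n)
          rw [← nsmul_eq_mul]
          exact sum_le_card_nsmul _ _ _ fun s hs => hP _ (hX n s hs)
      _ = (w n * #(S n)) * (ε / 4) := by ring
      _ ≤ 1 * (ε / 4) := mul_le_mul_of_nonneg_right hwn (by positivity)
      _ = ε / 4 := one_mul _
  rw [Real.dist_eq] at hn ⊢
  rw [abs_le] at h1 h2
  rw [abs_lt] at hn ⊢
  constructor <;> linarith

end Weierstrass

section Assembly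

theorem card_mulChar_le {p : ℕ} [hp : Fact p.Prime] (k : ℕ) :
    Fintype.card (MulChar (ZMod (p ^ k)) ℂ) ≤ p ^ k := by
  have : NeZero (p ^ k) := ⟨pow_ne_zero _ hp.out.ne_zero⟩
  rw [← Nat.card_eq_fintype_card]
  exact (DirichletCharacter.card_eq_totient_of_hasEnoughRootsOfUnity ℂ (p ^ k)).le.trans
    (Nat.totient_le _)

theorem tendsto_moment_nKloos {n : ℕ} (hn : n ≠ 0) {r : ℕ} (a : Fin r → ℤ)
    (ha : ∀ i, a i ≠ 0) (hdist : ∀ i j, i ≠ j → a i ≠ a j ∧ a i ≠ -a j) (e : Fin r → ℕ) :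
    Filter.Tendsto (fun p : ℕ => 1 / (p : ℝ) ^ (n + 1) *
        ∑ χ : MulChar (ZMod (p ^ (n + 1))) ℂ with ∀ i, |nKloos (p ^ (n + 1)) (a i) χ| ≤ 2,
          ∏ i, nKloos (p ^ (n + 1)) (a i) χ ^ e i)
      (Filter.atTop ⊓ Filter.principal {p : ℕ | p.Prime})
      (nhds (∫ x, ∏ i, x i ^ e i ∂(Measure.pi fun _ : Fin r => muK))) := by
  rw [integral_prod_pow_pi_muK, Metric.tendsto_nhds]
  intro ε hε
  obtain ⟨P, hP⟩ := exists_forall_abs_moment_sub_le hn a ha hdist e (half_pos hε)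
  rw [Filter.eventually_inf_principal]
  filter_upwards [Filter.eventually_ge_atTop P] with p hpP hp
  have : Fact p.Prime := ⟨hp⟩
  rw [Real.dist_eq]
  exact (hP p hpP).trans_lt (half_lt_self hε)

theorem tendsto_sum_nKloos_of_abs_le_two {n : ℕ} (hn : n ≠ 0) {r : ℕ} (a : Fin r → ℤ)
    (ha : ∀ i, a i ≠ 0) (hdist : ∀ i j, i ≠ j → a i ≠ a j ∧ a i ≠ -a j)
    (g : C(Fin r → ℝ, ℝ)) :
    Filter.Tendsto (fun p : ℕ => 1 / (p : ℝ) ^ (n + 1) *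
        ∑ χ : MulChar (ZMod (p ^ (n + 1))) ℂ with ∀ i, |nKloos (p ^ (n + 1)) (a i) χ| ≤ 2,
          g fun i => nKloos (p ^ (n + 1)) (a i) χ)
      (Filter.atTop ⊓ Filter.principal {p : ℕ | p.Prime})
      (nhds (∫ x, g x ∂(Measure.pi fun _ : Fin r => muK))) := by
  refine tendsto_sum_of_tendsto_moments
    (ι := fun p : ℕ => MulChar (ZMod (p ^ (n + 1))) ℂ)
    (fun p => {χ | ∀ i, |nKloos (p ^ (n + 1)) (a i) χ| ≤ 2})
    (fun p χ i => nKloos (p ^ (n + 1)) (a i) χ) (fun p => 1 / (p : ℝ) ^ (n + 1))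
    (fun p => by positivity) ?_ (fun p χ hχ i => abs_le.1 ((mem_filter.1 hχ).2 i))
    ae_pi_muK_mem_Icc (tendsto_moment_nKloos hn a ha hdist) g
  rw [Filter.eventually_inf_principal]
  refine Filter.Eventually.of_forall fun p hp => ?_
  have : Fact p.Prime := ⟨hp⟩
  have hp0 : (0 : ℝ) < p := by exact_mod_cast hp.pos
  rw [div_mul_eq_mul_div, one_mul, div_le_one (by positivity)]
  exact_mod_cast (card_le_univ _).trans (card_mulChar_le (p := p) (n + 1))

theorem tendsto_sum_nKloos_of_two_lt_abs {n : ℕ} (hn : n ≠ 0) {r : ℕ} (a : Fin r → ℤ)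
    (ha : ∀ i, a i ≠ 0) (hdist : ∀ i j, i ≠ j → a i ≠ a j ∧ a i ≠ -a j)
    (g : BoundedContinuousFunction (Fin r → ℝ) ℝ) :
    Filter.Tendsto (fun p : ℕ => 1 / (p : ℝ) ^ (n + 1) *
        ∑ χ : MulChar (ZMod (p ^ (n + 1))) ℂ with ¬∀ i, |nKloos (p ^ (n + 1)) (a i) χ| ≤ 2,
          g fun i => nKloos (p ^ (n + 1)) (a i) χ)
      (Filter.atTop ⊓ Filter.principal {p : ℕ | p.Prime}) (nhds 0) := by
  have hlim : Filter.Tendsto (fun p : ℕ => 2 * r / (p : ℝ) * ‖g‖)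
      (Filter.atTop ⊓ Filter.principal {p : ℕ | p.Prime}) (nhds 0) := by
    have := (tendsto_const_div_atTop_nhds_zero_nat (2 * r : ℝ)).mul_const ‖g‖
    rw [zero_mul] at this
    exact this.mono_left inf_le_left
  refine squeeze_zero_norm' ?_ hlim
  obtain ⟨P, hP⟩ := exists_forall_intCast_ne a ha hdist
  rw [Filter.eventually_inf_principal]
  filter_upwards [Filter.eventually_ge_atTop (max P 3)] with p hpP hp
  have : Fact p.Prime := ⟨hp⟩
  have hcard := card_two_lt_abs_nKloos_div_le (p := p)
    (by have := (le_max_right P 3).trans hpP; omega) hn (hP p ((le_max_left P 3).trans hpP)).1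
  refine le_trans ?_ (mul_le_mul_of_nonneg_right hcard (norm_nonneg g))
  rw [norm_mul, Real.norm_of_nonneg (by positivity), mul_assoc]
  refine mul_le_mul_of_nonneg_left ((norm_sum_le _ _).trans ?_) (by positivity)
  rw [← nsmul_eq_mul]
  exact sum_le_card_nsmul _ _ _ fun χ _ => g.norm_coe_le_norm _

end Assembly

/-- **Equidistribution of twisted Kloosterman sums modulo prime powers.**
For fixed distinct nonzero integers `a₁,…,a_r` (with `a_i ≠ ±a_j` for `i ≠ j`) and
fixed `k > 1`, for every bounded continuous `g : ℝ^r → ℝ`,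
`(1/p^k) ∑_χ g(𝒦_{p^k}(a₁,χ),…,𝒦_{p^k}(a_r,χ))` converges, as `p → ∞` through the
primes, to `∫ g dμ^r`. -/
theorem kloosterman_equidistribution
    (r : ℕ) (hr : 1 ≤ r) (a : Fin r → ℤ) (ha : ∀ i, a i ≠ 0)
    (hdist : ∀ i j, i ≠ j → a i ≠ a j ∧ a i ≠ -a j)
    (k : ℕ) (hk : 1 < k)
    (g : BoundedContinuousFunction ((Fin r) → ℝ) ℝ) :
    Filter.Tendsto
      (fun p : ℕ =>
        (1 / (p ^ k : ℝ)) *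
          ∑ χ : MulChar (ZMod (p ^ k)) ℂ, g (fun i => nKloos (p ^ k) (a i) χ))
      (Filter.atTop ⊓ Filter.principal {p : ℕ | p.Prime})
      (nhds (∫ x, g x ∂(Measure.pi fun _ : Fin r => muK))) := by
  obtain ⟨n, rfl⟩ := Nat.exists_eq_succ_of_ne_zero (by omega : k ≠ 0)
  have hn : n ≠ 0 := by omega
  have h := (tendsto_sum_nKloos_of_abs_le_two hn a ha hdist g.toContinuousMap).add
    (tendsto_sum_nKloos_of_two_lt_abs hn a ha hdist g)
  rw [add_zero] at h
  refine h.congr fun p => ?_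
  rw [← mul_add]
  congr 1
  exact sum_filter_add_sum_filter_not _ _ _
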